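/- arXiv:math/0409517 — 7 statements merged into one kernel-verified Lean document; each statement's English description precedes it below -/
import Mathlib

section
/- Every commutative arithmetic ring R has λ-dimension at most 3. -/
open DirectSum

universe u

/-- A finite `n`-presentation of an `R`-module `E`: an exact sequence
`F_n → ⋯ → F_1 → F_0 → E → 0` with each `F_i` a finitely generated free module. -/
def HasFiniteNPresentation (R : Type u) [CommRing R] (E : Type u) [AddCommGroup E]
    [Module R E] (n : ℕ) : Prop :=
  ∃ (k : ℕ → ℕ) (f : ∀ i : ℕ, ((Fin (k (i + 1)) → R) →ₗ[R] (Fin (k i) → R)))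
    (g : ((Fin (k 0) → R) →ₗ[R] E)),
    Function.Surjective g ∧
    (0 < n → LinearMap.range (f 0) = LinearMap.ker g) ∧
    (∀ i : ℕ, i + 1 < n → LinearMap.range (f (i + 1)) = LinearMap.ker (f i))

/-- `λ-dim R ≤ n` : every module having a finite `n`-presentation has finite
`m`-presentations for all `m`, i.e. `λ_R(E) ≥ n → λ_R(E) = ∞`. -/
def LambdaDimLE (R : Type u) [CommRing R] (n : ℕ) : Prop :=
  ∀ (E : Type u) [AddCommGroup E] [Module R E],
    HasFiniteNPresentation R E n → ∀ m : ℕ, HasFiniteNPresentation R E m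

/-- `R` is arithmetic: the localization at every maximal ideal is a valuation ring,
i.e. its ideals are totally ordered by inclusion. -/
def IsArithmetic (R : Type u) [CommRing R] : Prop :=
  ∀ (M : Ideal R) (hM : M.IsMaximal),
    letI := hM.isPrime
    ∀ I J : Ideal (Localization.AtPrime M), I ≤ J ∨ J ≤ I

/-- `R` is self fp-injective: `Ext¹_R(F, R) = 0` for every finitely presented module `F`. -/
def SelfFPInjective (R : Type u) [CommRing R] : Prop :=
  ∀ (F : ModuleCat.{u} R), Module.FinitePresentation R F →
    Subsingleton (((Ext R (ModuleCat.{u} R) 1).obj (Opposite.op F)).obj (ModuleCat.of R R))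

/-- A coherent ring: every finitely generated ideal is finitely presented. -/
def IsCoherentRing (R : Type u) [CommRing R] : Prop :=
  ∀ I : Ideal R, I.FG → Module.FinitePresentation R I

/-- flat dimension of `E` at most `n`: the least `m` such that
`Tor_{m+1}(F, E) = 0` for all `F` is at most `n`. -/
def FlatDimLE (R : Type u) [CommRing R] (E : Type u) [AddCommGroup E] [Module R E]
    (n : ℕ) : Prop :=
  ∃ m ≤ n, ∀ (F : Type u) [AddCommGroup F] [Module R F],
    Subsingleton (((CategoryTheory.Tor (ModuleCat.{u} R) (m + 1)).obj (ModuleCat.of R F)).obj (ModuleCat.of R E))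

/-- Hermite ring. -/
def IsHermiteRing (R : Type u) [CommRing R] : Prop :=
  ∀ a b : R, ∃ d a' b' : R, a = d * a' ∧ b = d * b' ∧
    Ideal.span {a'} + Ideal.span {b'} = ⊤

/-- Kaplansky (elementary divisor) ring. -/
def IsKaplanskyRing (R : Type u) [CommRing R] : Prop :=
  ∀ (m n : ℕ) (A : Matrix (Fin m) (Fin n) R),
    ∃ (P : Matrix (Fin m) (Fin m) R) (Q : Matrix (Fin n) (Fin n) R),
      IsUnit P ∧ IsUnit Q ∧ ∀ (i : Fin m) (j : Fin n), (i : ℕ) ≠ (j : ℕ) → (P * A * Q) i j = 0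

/-- Adequate ring. -/
def IsAdequateRing (R : Type u) [CommRing R] : Prop :=
  IsBezout R ∧ ∀ a b : R, a ≠ 0 → ∃ r s : R,
    a = r * s ∧ Ideal.span {r} + Ideal.span {b} = ⊤ ∧
    ∀ s' : R, ¬ IsUnit s' → s' ∣ s → Ideal.span {s'} + Ideal.span {b} ≠ ⊤

/-- The minimal prime spectrum with the subspace topology from `Spec R`. -/
def MinSpec (R : Type u) [CommRing R] : Type u :=
  {P : PrimeSpectrum R // P.asIdeal ∈ minimalPrimes R}

instance (R : Type u) [CommRing R] : TopologicalSpace (MinSpec R) :=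
  instTopologicalSpaceSubtype

/-- Fractionally self fp-injective: for every proper ideal `A`, the classical
quotient ring `Q(R/A)` is self fp-injective. -/
def FractionallySelfFPInjective (R : Type u) [CommRing R] : Prop :=
  ∀ A : Ideal R, A ≠ ⊤ → SelfFPInjective (FractionRing (R ⧸ A))

/-- CF ring: every finite direct sum of cyclic modules has a canonical form. -/
def IsCFRing (R : Type u) [CommRing R] : Prop :=
  ∀ (n : ℕ) (I : Fin n → Ideal R),
    ∃ (m : ℕ) (J : Fin m → Ideal R),
      (∀ i j : Fin m, i ≤ j → J i ≤ J j) ∧ (∀ j : Fin m, J j ≠ ⊤) ∧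
      Nonempty ((⨁ i, R ⧸ I i) ≃ₗ[R] (⨁ j, R ⧸ J j))

universe v w

/-- A module is `2`-presented if it is finitely generated and the kernel of every surjection from a
finite free module onto it is finitely presented. -/
def IsTwoPresented (R : Type u) [CommRing R] (M : Type v) [AddCommGroup M] [Module R M] : Prop :=
  Module.Finite R M ∧ ∀ (k : ℕ) (p : (Fin k → R) →ₗ[R] M), Function.Surjective p →
    Module.FinitePresentation R (LinearMap.ker p)

/-- An elementwise form of arithmeticity: for any two elements, the spectrum is covered by two basic
open sets on each of which one of the elements divides the other. -/
def LocallyComparable (R : Type u) [CommRing R] : Prop :=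
  ∀ a b : R, ∃ t : R, b ∣ t * a ∧ a ∣ (1 - t) * b

section Modules

variable {R : Type u} [CommRing R] {M : Type v} [AddCommGroup M] [Module R M]
  {N : Type w} [AddCommGroup N] [Module R N]

theorem Module.FinitePresentation.fst_of_prod (h : Module.FinitePresentation R (M × N)) :
    Module.FinitePresentation R M := by
  have : Module.Finite R N :=
    Module.Finite.of_surjective (LinearMap.snd R M N) LinearMap.snd_surjective
  refine Module.finitePresentation_of_surjective (LinearMap.fst R M N) LinearMap.fst_surjective ?_
  rw [LinearMap.ker_fst, ← Module.Finite.iff_fg]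
  infer_instance

theorem Module.FinitePresentation.snd_of_prod (h : Module.FinitePresentation R (M × N)) :
    Module.FinitePresentation R N :=
  Module.FinitePresentation.fst_of_prod (.of_equiv (LinearEquiv.prodComm R M N))

/-- A form of Schanuel's lemma. -/
theorem Module.FinitePresentation.ker_of_ker {F G : Type*} [AddCommGroup F] [Module R F]
    [AddCommGroup G] [Module R G] [Module.Projective R F] [Module.Finite R F]
    [Module.Projective R G] [Module.Finite R G] (p : F →ₗ[R] M) (q : G →ₗ[R] M)
    (hp : Function.Surjective p) (hq : Function.Surjective q)
    (h : Module.FinitePresentation R (LinearMap.ker p)) :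
    Module.FinitePresentation R (LinearMap.ker q) := by
  obtain ⟨t, ht⟩ := Module.projective_lifting_property q p hq
  obtain ⟨v, hv⟩ := Module.projective_lifting_property p q hp
  replace ht : ∀ x, q (t x) = p x := fun x ↦ LinearMap.congr_fun ht x
  replace hv : ∀ x, p (v x) = q x := fun x ↦ LinearMap.congr_fun hv x
  have : Module.FinitePresentation R G := Module.finitePresentation_of_projective R G
  let l : (LinearMap.ker p × G) →ₗ[R] LinearMap.ker q :=
    LinearMap.codRestrict _
      (LinearMap.coprod (t ∘ₗ (LinearMap.ker p).subtype) (LinearMap.id - t ∘ₗ v))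
      (by rintro ⟨⟨x, hx⟩, y⟩; rw [LinearMap.mem_ker] at hx; simp [*])
  let z : F →ₗ[R] (LinearMap.ker p × G) :=
    LinearMap.prod (LinearMap.codRestrict _ (v ∘ₗ t - LinearMap.id) (by intro x; simp [ht, hv])) t
  have hl : ∀ x : LinearMap.ker p × G, (l x : G) = t x.1 + (x.2 - t (v x.2)) := fun x ↦ rfl
  refine Module.finitePresentation_of_surjective l ?_ ?_
  · rintro ⟨y, hy⟩
    refine ⟨(⟨v y, by simp_all⟩, y), Subtype.ext ?_⟩
    simp [hl]
  · have : LinearMap.ker l = LinearMap.range z := by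
      ext ⟨⟨x, hx⟩, y⟩
      constructor
      · intro h
        have h' : t x + (y - t (v y)) = 0 := by
          rw [← hl (⟨x, hx⟩, y), LinearMap.mem_ker.mp h]; rfl
        have h2 : t (v y - x) = y := by
          rw [map_sub, ← sub_eq_zero, ← neg_eq_zero, ← h']; abel
        refine ⟨v y - x, Prod.ext (Subtype.ext ?_) h2⟩
        change v (t (v y - x)) - (v y - x) = x
        rw [h2]; abel
      · rintro ⟨s, hs⟩
        have h1 : v (t s) - s = x := congrArg (fun a ↦ (a.1 : F)) hs
        have h2 : t s = y := congrArg Prod.snd hs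
        refine LinearMap.mem_ker.mpr (Subtype.ext ?_)
        rw [hl]
        simp [← h1, ← h2]
    rw [this, ← Module.Finite.iff_fg]
    infer_instance

namespace IsTwoPresented

theorem of_surjective {F : Type*} [AddCommGroup F] [Module R F] [Module.Projective R F]
    [Module.Finite R F] (p : F →ₗ[R] M) (hp : Function.Surjective p)
    (h : Module.FinitePresentation R (LinearMap.ker p)) : IsTwoPresented R M :=
  ⟨.of_surjective p hp, fun _ q hq ↦ .ker_of_ker p q hp hq h⟩

theorem of_projective [Module.Projective R M] [Module.Finite R M] : IsTwoPresented R M :=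
  of_surjective LinearMap.id Function.surjective_id (by rw [LinearMap.ker_id]; infer_instance)

theorem of_equiv (e : M ≃ₗ[R] N) (h : IsTwoPresented R M) : IsTwoPresented R N := by
  obtain ⟨h1, h2⟩ := h
  obtain ⟨k, p, hp⟩ := Module.Finite.exists_fin' R M
  refine of_surjective (e.toLinearMap ∘ₗ p) (e.surjective.comp hp) ?_
  rw [LinearEquiv.ker_comp]
  exact h2 k p hp

theorem prod (hM : IsTwoPresented R M) (hN : IsTwoPresented R N) : IsTwoPresented R (M × N) := by
  obtain ⟨h1, h2⟩ := hM
  obtain ⟨h3, h4⟩ := hN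
  obtain ⟨k, p, hp⟩ := Module.Finite.exists_fin' R M
  obtain ⟨l, q, hq⟩ := Module.Finite.exists_fin' R N
  refine of_surjective (p.prodMap q) (hp.prodMap hq) ?_
  rw [LinearMap.ker_prodMap]
  have := h2 k p hp
  have := h4 l q hq
  exact .of_equiv (M := LinearMap.ker p × LinearMap.ker q)
    { toFun x := ⟨(x.1, x.2), x.1.2, x.2.2⟩
      invFun x := (⟨x.1.1, x.2.1⟩, ⟨x.1.2, x.2.2⟩)
      map_add' _ _ := rfl
      map_smul' _ _ := rfl }

theorem of_localizationSpan (s : Set R) (hs : Ideal.span s = ⊤)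
    (H : ∀ r ∈ s, IsTwoPresented (Localization.Away r) (LocalizedModule.Away r M)) :
    IsTwoPresented R M := by
  refine ⟨Module.Finite.of_localizationSpan s hs fun r ↦ (H r.1 r.2).1, fun k p hp ↦ ?_⟩
  let g (r : s) : (Fin k → R) →ₗ[R] (Fin k → Localization.Away r.1) :=
    .pi fun i ↦ Algebra.linearMap R (Localization.Away r.1) ∘ₗ .proj i
  have hg (r : s) : IsLocalizedModule (Submonoid.powers r.1) (g r) :=
    IsLocalizedModule.pi _ fun _ ↦ Algebra.linearMap R (Localization.Away r.1)
  refine Module.FinitePresentation.of_localizationSpan' s hs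
    (Rₚ := fun r ↦ Localization.Away r.1)
    (fun r ↦ (LinearMap.ker p).toLocalized' (Localization.Away r.1) (Submonoid.powers r.1) (g r))
    fun r ↦ ?_
  rw [LinearMap.localized'_ker_eq_ker_localizedMap (Localization.Away r.1) (Submonoid.powers r.1)
    (g r) (LocalizedModule.mkLinearMap (Submonoid.powers r.1) M) p]
  exact (H r.1 r.2).2 k _ (IsLocalizedModule.map_surjective _ _ _ _ hp)

end IsTwoPresented

theorem LinearMap.nonempty_localizedModule_ker_equiv (S : Submonoid R) {M' N' : Type*}
    [AddCommGroup M'] [Module R M'] [Module (Localization S) M']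
    [IsScalarTower R (Localization S) M'] [AddCommGroup N'] [Module R N']
    [Module (Localization S) N'] [IsScalarTower R (Localization S) N']
    (g : M →ₗ[R] M') [IsLocalizedModule S g] (g' : N →ₗ[R] N') [IsLocalizedModule S g']
    (f : M →ₗ[R] N) (f' : M' →ₗ[Localization S] N') (h : ∀ x, f' (g x) = g' (f x)) :
    Nonempty (LocalizedModule S (LinearMap.ker f) ≃ₗ[Localization S] LinearMap.ker f') := by
  have hf' : f' = (IsLocalizedModule.map S g g' f).extendScalarsOfIsLocalization S
      (Localization S) := by
    apply LinearMap.restrictScalars_injective R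
    apply IsLocalizedModule.linearMap_ext S g g'
    ext x
    simp [h]
  have e1 := (IsLocalizedModule.linearEquiv S (LocalizedModule.mkLinearMap S (LinearMap.ker f))
    ((LinearMap.ker f).toLocalized' (Localization S) S g)).extendScalarsOfIsLocalization S
      (Localization S)
  refine ⟨e1.trans (LinearEquiv.ofEq _ _ ?_)⟩
  rw [LinearMap.localized'_ker_eq_ker_localizedMap (Localization S) S g g' f, hf']

end Modules

namespace LocallyComparable

theorem localization {R : Type u} [CommRing R] (hR : LocallyComparable R) (S : Submonoid R) :
    LocallyComparable (Localization S) := by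
  intro a b
  obtain ⟨⟨a', s⟩, ha⟩ := IsLocalization.surj S a
  obtain ⟨⟨b', s'⟩, hb⟩ := IsLocalization.surj S b
  have hs := IsLocalization.map_units (Localization S) s
  have hs' := IsLocalization.map_units (Localization S) s'
  obtain ⟨t, h1, h2⟩ := hR a' b'
  replace h1 := map_dvd (algebraMap R (Localization S)) h1
  replace h2 := map_dvd (algebraMap R (Localization S)) h2
  simp only [map_mul, map_sub, map_one, ← ha, ← hb] at h1 h2
  refine ⟨algebraMap R _ t, ?_, ?_⟩
  · rw [← hs.dvd_mul_right, mul_assoc]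
    exact (dvd_mul_right _ _).trans h1
  · rw [← hs'.dvd_mul_right, mul_assoc]
    exact (dvd_mul_right _ _).trans h2

theorem span_dvd_eq_top {R : Type u} [CommRing R] (hR : LocallyComparable R) {ι : Type*}
    [Finite ι] [Nonempty ι] (x : ι → R) :
    Ideal.span {r : R | ∃ i, ∀ j, x i ∣ r * x j} = ⊤ := by
  classical
  by_contra hne
  obtain ⟨P, hP, hle⟩ := Ideal.exists_le_maximal _ hne
  have := hP.isPrime
  have key : ∀ s : Finset ι, s.Nonempty → ∃ i, ∃ r ∉ P, ∀ j ∈ s, x i ∣ r * x j := by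
    intro s hs
    induction hs using Finset.Nonempty.cons_induction with
    | singleton a => exact ⟨a, 1, fun h ↦ hP.ne_top (P.eq_top_of_isUnit_mem h isUnit_one), by simp⟩
    | cons a s has hs ih =>
      obtain ⟨i, r, hr, h⟩ := ih
      obtain ⟨t, h1, h2⟩ := hR (x a) (x i)
      by_cases ht : t ∈ P
      · have ht' : 1 - t ∉ P := fun h' ↦ hP.ne_top
          (P.eq_top_of_isUnit_mem (by simpa using P.add_mem h' ht) isUnit_one)
        refine ⟨a, (1 - t) * r, fun h ↦ (this.mem_or_mem h).elim ht' hr, ?_⟩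
        intro j hj
        rcases Finset.mem_cons.mp hj with rfl | hj
        · exact dvd_mul_left _ _
        · rw [mul_assoc]
          exact h2.trans (mul_dvd_mul_left _ (h j hj))
      · refine ⟨i, r * t, fun h ↦ (this.mem_or_mem h).elim hr ht, ?_⟩
        intro j hj
        rcases Finset.mem_cons.mp hj with rfl | hj
        · rw [mul_assoc]
          exact h1.mul_left r
        · rw [mul_right_comm]
          exact (h j hj).mul_right t
  have := Fintype.ofFinite ι
  obtain ⟨i, r, hr, h⟩ := key Finset.univ Finset.univ_nonempty
  exact hr (hle (Ideal.subset_span ⟨i, fun j ↦ h j (Finset.mem_univ j)⟩))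

theorem span_principal_eq_top {R : Type u} [CommRing R] (hR : LocallyComparable R) (I : Ideal R)
    (hI : I.FG) : Ideal.span {r : R | ∃ b ∈ I, ∀ y ∈ I, b ∣ r * y} = ⊤ := by
  classical
  obtain ⟨S, rfl⟩ := hI
  have : Nonempty (insert 0 S : Finset R) := ⟨⟨0, Finset.mem_insert_self 0 S⟩⟩
  rw [eq_top_iff, ← hR.span_dvd_eq_top (fun i : (insert 0 S : Finset R) ↦ (i : R))]
  refine Ideal.span_mono ?_
  rintro r ⟨⟨b, hb⟩, h⟩
  refine ⟨b, ?_, fun y hy ↦ ?_⟩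
  · rcases Finset.mem_insert.mp hb with rfl | hb
    · exact zero_mem _
    · exact Ideal.subset_span hb
  · induction hy using Submodule.span_induction with
    | mem y hy => exact h ⟨y, Finset.mem_insert_of_mem hy⟩
    | zero => simp
    | add y z _ _ hy hz => rw [mul_add]; exact dvd_add hy hz
    | smul c y _ hy => rw [smul_eq_mul, mul_left_comm]; exact hy.mul_left c

end LocallyComparable

section Annihilator

open LinearMap (ker toSpanSingleton)

theorem Localization.mul_eq_zero_iff_dvd {R : Type u} [CommRing R] (S : Submonoid R) {a b r : R}
    (hr : r ∈ S) (hab : b * a = 0) (h : ∀ y, y * a = 0 → b ∣ r * y) (y : Localization S) :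
    y * algebraMap R _ a = 0 ↔ algebraMap R _ b ∣ y := by
  constructor
  · intro hy
    obtain ⟨⟨y', s⟩, hs⟩ := IsLocalization.surj S y
    have h0 : algebraMap R (Localization S) (y' * a) = algebraMap R _ 0 := by
      rw [map_mul, ← hs, mul_right_comm, hy, zero_mul, map_zero]
    obtain ⟨c, hc⟩ := IsLocalization.exists_of_eq (M := S) h0
    have h1 := map_dvd (algebraMap R (Localization S))
      (h (c * y') (by rw [mul_assoc, hc, mul_zero]))
    rw [map_mul, map_mul, ← hs] at h1
    have hu := IsLocalization.map_units (Localization S) (⟨r, hr⟩ : S)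
    rwa [hu.dvd_mul_left, (IsLocalization.map_units (Localization S) c).dvd_mul_left,
      (IsLocalization.map_units (Localization S) s).dvd_mul_right] at h1
  · rintro ⟨c, rfl⟩
    rw [mul_right_comm, ← map_mul, hab, map_zero, zero_mul]

variable {R : Type u} [CommRing R]

theorem nonempty_localizedModule_ker_toSpanSingleton_equiv (S : Submonoid R) (a : R) :
    Nonempty (LocalizedModule S (ker (toSpanSingleton R R a)) ≃ₗ[Localization S]
      ker (toSpanSingleton (Localization S) (Localization S) (algebraMap R _ a))) :=
  LinearMap.nonempty_localizedModule_ker_equiv S (Algebra.linearMap R (Localization S))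
    (Algebra.linearMap R (Localization S)) _ _ (by simp)

theorem IsTwoPresented.ker_toSpanSingleton_of_cover (a : R) (s : Set R) (hs : Ideal.span s = ⊤)
    (H : ∀ r ∈ s, IsTwoPresented (Localization.Away r) (ker (toSpanSingleton (Localization.Away r)
      (Localization.Away r) (algebraMap R _ a)))) :
    IsTwoPresented R (ker (toSpanSingleton R R a)) := by
  refine .of_localizationSpan s hs fun r hr ↦ ?_
  obtain ⟨e⟩ := nonempty_localizedModule_ker_toSpanSingleton_equiv (Submonoid.powers r) a
  exact (H r hr).of_equiv e.symm

theorem Module.FinitePresentation.ker_toSpanSingleton_localization (S : Submonoid R) (a : R)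
    (h : Module.FinitePresentation R (ker (toSpanSingleton R R a))) :
    Module.FinitePresentation (Localization S)
      (ker (toSpanSingleton (Localization S) (Localization S) (algebraMap R _ a))) := by
  obtain ⟨e⟩ := nonempty_localizedModule_ker_toSpanSingleton_equiv S a
  exact .of_equiv e

/-- Multiplication by a generator of the annihilator of `a`, as a map onto that annihilator. -/
theorem exists_surjective_ker_toSpanSingleton {a b : R} (hb : ∀ y, y * a = 0 ↔ b ∣ y) :
    ∃ p : R →ₗ[R] ker (toSpanSingleton R R a), Function.Surjective p ∧
      ker p = ker (toSpanSingleton R R b) := by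
  refine ⟨LinearMap.codRestrict _ (toSpanSingleton R R b) fun c ↦ ?_, ?_, ?_⟩
  · simpa using (hb (c * b)).mpr (dvd_mul_left _ _)
  · rintro ⟨y, hy⟩
    obtain ⟨c, rfl⟩ := (hb y).mp (by simpa using hy)
    exact ⟨c, Subtype.ext (by simp [mul_comm])⟩
  · exact LinearMap.ker_codRestrict _ _ _

theorem IsTwoPresented.ker_toSpanSingleton_of_dvd {a b : R} (hb : ∀ y, y * a = 0 ↔ b ∣ y)
    (ha : ∀ y, y * b = 0 → a ∣ y) : IsTwoPresented R (ker (toSpanSingleton R R a)) := by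
  obtain ⟨p, hp, hker⟩ := exists_surjective_ker_toSpanSingleton hb
  refine .of_surjective p hp ?_
  rw [hker]
  obtain ⟨q, hq, hker'⟩ := exists_surjective_ker_toSpanSingleton (a := b) (b := a) fun y ↦
    ⟨ha y, by rintro ⟨c, rfl⟩; rw [mul_right_comm, mul_comm a b, (hb b).mpr dvd_rfl, zero_mul]⟩
  refine Module.finitePresentation_of_surjective q hq ?_
  rw [hker', ← Module.Finite.iff_fg]
  exact .of_surjective p hp

namespace LocallyComparable

theorem isTwoPresented_ker_of_principal (hR : LocallyComparable R) {a b x : R}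
    (hb : ∀ y, y * a = 0 ↔ b ∣ y) (hx : ∀ y, y * b = 0 ↔ x ∣ y) :
    IsTwoPresented R (ker (toSpanSingleton R R a)) := by
  have hab : b * a = 0 := (hb b).mpr dvd_rfl
  have hxb : x * b = 0 := (hx x).mpr dvd_rfl
  obtain ⟨c, hc⟩ : x ∣ a := (hx a).mp (by rw [mul_comm, hab])
  refine .ker_toSpanSingleton_of_cover a {r | r * b = 0 ∨ r * a = 0 ∨ a ∣ r * x} ?_ ?_
  · obtain ⟨t, ⟨d, hd⟩, ⟨e, he⟩⟩ := hR c b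
    obtain ⟨e', rfl⟩ := (hb e).mp (by linear_combination e * hc - x * he + (1 - t) * hxb)
    rw [Ideal.eq_top_iff_one,
      show (1 : R) = t + (1 - t - c * e') + c * e' by ring]
    refine add_mem (add_mem (Ideal.subset_span (.inr (.inl ?_))) (Ideal.subset_span (.inl ?_)))
      (Ideal.subset_span (.inr (.inr ⟨e', ?_⟩)))
    · linear_combination t * hc + x * hd + d * hxb
    · linear_combination he
    · linear_combination -e' * hc
  · intro r hr
    have hu : IsUnit (algebraMap R (Localization.Away r) r) :=
      IsLocalization.Away.algebraMap_isUnit r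
    have hzero : ∀ y, r * y = 0 → algebraMap R (Localization.Away r) y = 0 := fun y hy ↦ by
      rw [← hu.mul_right_eq_zero, ← map_mul, hy, map_zero]
    have hb' := Localization.mul_eq_zero_iff_dvd (Submonoid.powers r) (one_mem _) hab
      (by simp [hb])
    rcases hr with hr | hr | hr
    · have h : ker (toSpanSingleton (Localization.Away r) (Localization.Away r)
          (algebraMap R _ a)) = ⊥ := by
        rw [eq_bot_iff]
        intro y hy
        have := (hb' y).mp (by simpa using hy)
        rw [hzero b hr, zero_dvd_iff] at this
        simpa using this
      rw [h]
      exact .of_projective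
    · rw [hzero a hr, LinearMap.toSpanSingleton_zero, LinearMap.ker_zero]
      exact .of_equiv Submodule.topEquiv.symm .of_projective
    · refine .ker_toSpanSingleton_of_dvd hb' fun y hy ↦ ?_
      refine dvd_trans ?_ ((Localization.mul_eq_zero_iff_dvd (Submonoid.powers r) (one_mem _) hxb
        (by simp [hx]) y).mp hy)
      rw [← hu.dvd_mul_left, ← map_mul]
      exact map_dvd _ hr

theorem isTwoPresented_ker_of_mul_eq_zero_iff_dvd (hR : LocallyComparable R) {a b : R}
    (hb : ∀ y, y * a = 0 ↔ b ∣ y)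
    (h : Module.FinitePresentation R (ker (toSpanSingleton R R a))) :
    IsTwoPresented R (ker (toSpanSingleton R R a)) := by
  obtain ⟨p, hp, hker⟩ := exists_surjective_ker_toSpanSingleton hb
  refine .ker_toSpanSingleton_of_cover a _
    (hR.span_principal_eq_top (ker (toSpanSingleton R R b)) (hker ▸ h.fg_ker p hp)) ?_
  rintro r ⟨x, hx, hxr⟩
  exact (hR.localization (Submonoid.powers r)).isTwoPresented_ker_of_principal
    (Localization.mul_eq_zero_iff_dvd _ (one_mem _) ((hb b).mpr dvd_rfl) (by simp [hb]))
    (Localization.mul_eq_zero_iff_dvd _ (Submonoid.mem_powers r) (by simpa using hx)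
      (by simpa using hxr))

theorem isTwoPresented_ker_toSpanSingleton (hR : LocallyComparable R) (a : R)
    (h : Module.FinitePresentation R (ker (toSpanSingleton R R a))) :
    IsTwoPresented R (ker (toSpanSingleton R R a)) := by
  refine .ker_toSpanSingleton_of_cover a _
    (hR.span_principal_eq_top (ker (toSpanSingleton R R a)) (Module.Finite.iff_fg.mp inferInstance))
    ?_
  rintro r ⟨b, hb, hbr⟩
  exact (hR.localization (Submonoid.powers r)).isTwoPresented_ker_of_mul_eq_zero_iff_dvd
    (Localization.mul_eq_zero_iff_dvd _ (Submonoid.mem_powers r) (by simpa using hb)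
      (by simpa using hbr))
    (h.ker_toSpanSingleton_localization _ _)

end LocallyComparable

end Annihilator

section Matrix

open LinearMap (ker toSpanSingleton)

variable {R : Type u} [CommRing R]

/-- Splitting off a pivot that divides all entries. -/
theorem LinearMap.nonempty_ker_smul_equiv_prod {M : Type v} [AddCommGroup M] [Module R M]
    {N : Type w} [AddCommGroup N] [Module R N] (a : R) (g : R × M →ₗ[R] R × N)
    (hg : (g (1, 0)).1 = 1) :
    ∃ f : M →ₗ[R] N,
      Nonempty (ker (a • g) ≃ₗ[R] ker (toSpanSingleton R R a) × ker f) := by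
  obtain ⟨v, hv⟩ : ∃ v, g (1, 0) = (1, v) := ⟨_, Prod.ext hg rfl⟩
  let ψ : M →ₗ[R] R := LinearMap.fst R R N ∘ₗ g ∘ₗ LinearMap.inr R R M
  let g' : M →ₗ[R] N := LinearMap.snd R R N ∘ₗ g ∘ₗ LinearMap.inr R R M
  let f : M →ₗ[R] N := a • (g' - toSpanSingleton R N v ∘ₗ ψ)
  have hgx (r : R) (m : M) : g (r, m) = (r + ψ m, r • v + g' m) := by
    have : ((r, m) : R × M) = r • (1, 0) + (0, m) := by simp
    rw [this, map_add, map_smul, hv]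
    simp [ψ, g', Prod.ext_iff]
  have hf (m : M) : f m = a • (g' m - ψ m • v) := rfl
  have hmem (r : R) (m : M) :
      (r, m) ∈ ker (a • g) ↔ (r + ψ m) * a = 0 ∧ f m = 0 := by
    rw [LinearMap.mem_ker, LinearMap.smul_apply, hgx, hf, Prod.smul_mk, Prod.mk_eq_zero,
      smul_eq_mul, mul_comm a]
    refine and_congr_right fun h ↦ ?_
    have : a • (r • v + g' m) = ((r + ψ m) * a) • v + a • (g' m - ψ m • v) := by module
    rw [this, h, zero_smul, zero_add]
  refine ⟨f, ⟨LinearEquiv.ofLinearMap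
    (LinearMap.prod
      (LinearMap.codRestrict _ (LinearMap.coprod LinearMap.id ψ ∘ₗ (ker (a • g)).subtype) ?_)
      (LinearMap.codRestrict _ (LinearMap.snd R R M ∘ₗ (ker (a • g)).subtype) ?_))
    (LinearMap.codRestrict _ (LinearMap.prod
      (LinearMap.coprod (Submodule.subtype _) (-(ψ ∘ₗ Submodule.subtype _)))
      (Submodule.subtype _ ∘ₗ LinearMap.snd _ _ _)) ?_) ?_ ?_⟩⟩
  · rintro ⟨⟨r, m⟩, h⟩
    simpa using ((hmem r m).mp h).1
  · rintro ⟨⟨r, m⟩, h⟩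
    simpa using ((hmem r m).mp h).2
  · rintro ⟨⟨r, hr⟩, ⟨m, hm⟩⟩
    refine (hmem _ _).mpr ⟨?_, ?_⟩
    · simpa using hr
    · simpa using hm
  · refine LinearMap.ext ?_
    rintro ⟨⟨r, hr⟩, ⟨m, hm⟩⟩
    refine Prod.ext (Subtype.ext ?_) (Subtype.ext ?_) <;> simp
  · refine LinearMap.ext ?_
    rintro ⟨⟨r, m⟩, h⟩
    refine Subtype.ext (Prod.ext ?_ ?_) <;> simp

theorem exists_eq_smul_of_dvd {m n : ℕ} (f : (Fin m → R) →ₗ[R] (Fin n → R)) (i : Fin n)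
    (j : Fin m) (h : ∀ i' j', f (Pi.single j 1) i ∣ f (Pi.single j' 1) i') :
    ∃ g : (Fin m → R) →ₗ[R] (Fin n → R), f = f (Pi.single j 1) i • g ∧ g (Pi.single j 1) i = 1 := by
  classical
  choose c hc using h
  obtain ⟨C, hC⟩ : ∃ C : Matrix (Fin n) (Fin m) R, ∀ i' j', C i' j' =
      if i' = i ∧ j' = j then 1 else c i' j' := ⟨fun _ _ ↦ _, fun _ _ ↦ rfl⟩
  refine ⟨C.mulVecLin, ?_, by simp [hC]⟩
  refine LinearMap.pi_ext' fun j' ↦ LinearMap.ext_ring (funext fun i' ↦ ?_)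
  simp only [LinearMap.comp_apply, LinearMap.single_apply, LinearMap.smul_apply, Pi.smul_apply,
    Matrix.mulVecLin_apply, Matrix.mulVec_single_one, smul_eq_mul, Matrix.col_apply, hC]
  split_ifs with h
  · rw [h.1, h.2, mul_one]
  · exact hc i' j'

/-- Swapping coordinates and splitting off the first one. -/
noncomputable def Fin.swapConsEquiv (R : Type u) [CommRing R] {m : ℕ} (j : Fin (m + 1)) :
    (R × (Fin m → R)) ≃ₗ[R] (Fin (m + 1) → R) :=
  (Fin.consLinearEquiv R fun _ ↦ R).trans (LinearEquiv.funCongrLeft R R (Equiv.swap 0 j))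

theorem Fin.swapConsEquiv_one_zero {m : ℕ} (j : Fin (m + 1)) :
    Fin.swapConsEquiv R j (1, 0) = Pi.single j 1 := by
  have h : (Fin.cons 1 0 : Fin (m + 1) → R) = Pi.single 0 1 := by
    ext k
    cases k using Fin.cases <;> simp
  ext k
  change (Fin.cons 1 0 : Fin (m + 1) → R) (Equiv.swap 0 j k) = _
  simp only [h, Pi.single_apply, Equiv.swap_apply_eq_iff, Equiv.swap_apply_left]

theorem Fin.swapConsEquiv_symm_fst {m : ℕ} (j : Fin (m + 1)) (x : Fin (m + 1) → R) :
    ((Fin.swapConsEquiv R j).symm x).1 = x j := by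
  simp [Fin.swapConsEquiv, LinearEquiv.funCongrLeft]

theorem LinearMap.nonempty_ker_equiv_prod_of_dvd {m n : ℕ}
    (f : (Fin (m + 1) → R) →ₗ[R] (Fin (n + 1) → R)) (i : Fin (n + 1)) (j : Fin (m + 1))
    (h : ∀ i' j', f (Pi.single j 1) i ∣ f (Pi.single j' 1) i') :
    ∃ f' : (Fin m → R) →ₗ[R] (Fin n → R),
      Nonempty (ker f ≃ₗ[R] ker (toSpanSingleton R R (f (Pi.single j 1) i)) × ker f') := by
  obtain ⟨g, hg, h1⟩ := exists_eq_smul_of_dvd f i j h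
  set a := f (Pi.single j 1) i
  let g' : R × (Fin m → R) →ₗ[R] R × (Fin n → R) :=
    (Fin.swapConsEquiv R i).symm.toLinearMap ∘ₗ g ∘ₗ (Fin.swapConsEquiv R j).toLinearMap
  obtain ⟨f', ⟨e⟩⟩ := LinearMap.nonempty_ker_smul_equiv_prod a g'
    (by simp [g', Fin.swapConsEquiv_symm_fst, Fin.swapConsEquiv_one_zero, h1])
  have hker : ker (a • g') = (ker f).comap (Fin.swapConsEquiv R j).toLinearMap := by
    ext x
    rw [LinearMap.mem_ker, Submodule.mem_comap, LinearMap.mem_ker, hg,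
      show (a • g') x = (Fin.swapConsEquiv R i).symm ((a • g) (Fin.swapConsEquiv R j x)) by
        simp [g'], LinearEquiv.map_eq_zero_iff]
    rfl
  exact ⟨f', ⟨((LinearEquiv.ofEq _ _ hker).trans
    ((Fin.swapConsEquiv R j).ofSubmodule' (ker f))).symm.trans e⟩⟩

theorem LocallyComparable.isTwoPresented_ker {R : Type u} [CommRing R] (hR : LocallyComparable R)
    {m n : ℕ} (f : (Fin m → R) →ₗ[R] (Fin n → R)) (hf : Module.FinitePresentation R (ker f)) :
    IsTwoPresented R (ker f) := by
  induction m generalizing R n with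
  | zero => exact .of_projective
  | succ m ih =>
    obtain _ | n := n
    · rw [show ker f = ⊤ from eq_top_iff.mpr fun x _ ↦ Subsingleton.elim _ _]
      exact .of_equiv Submodule.topEquiv.symm .of_projective
    · refine .of_localizationSpan _ (hR.span_dvd_eq_top
        fun ij : Fin (n + 1) × Fin (m + 1) ↦ f (Pi.single ij.2 1) ij.1) ?_
      rintro r ⟨⟨i, j⟩, hr⟩
      let S := Submonoid.powers r
      have hR' := hR.localization S
      let ι (k : ℕ) : (Fin k → R) →ₗ[R] (Fin k → Localization S) :=
        .pi fun i ↦ Algebra.linearMap R (Localization S) ∘ₗ .proj i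
      have hι (k : ℕ) : IsLocalizedModule S (ι k) :=
        IsLocalizedModule.pi _ fun _ ↦ Algebra.linearMap R (Localization S)
      let F := IsLocalizedModule.mapExtendScalars S (ι (m + 1)) (ι (n + 1)) (Localization S) f
      have hF (x) : F (ι (m + 1) x) = ι (n + 1) (f x) :=
        IsLocalizedModule.map_apply S (ι (m + 1)) (ι (n + 1)) f x
      have hentry (i' j') : F (Pi.single j' 1) i' = algebraMap R _ (f (Pi.single j' 1) i') := by
        have : (Pi.single j' 1 : Fin (m + 1) → Localization S) = ι (m + 1) (Pi.single j' 1) := by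
          ext k
          simp [ι, Pi.single_apply, apply_ite (algebraMap R (Localization S))]
        rw [this, hF]
        rfl
      obtain ⟨e⟩ := LinearMap.nonempty_localizedModule_ker_equiv S (ι (m + 1)) (ι (n + 1)) f F hF
      obtain ⟨F', ⟨e'⟩⟩ := LinearMap.nonempty_ker_equiv_prod_of_dvd F i j fun i' j' ↦ by
        rw [hentry, hentry, ← (IsLocalization.Away.algebraMap_isUnit (S := Localization S)
          r).dvd_mul_left, ← map_mul]
        exact map_dvd _ (hr (i', j'))
      have hprod :=
        Module.FinitePresentation.of_equiv (M := LocalizedModule S (ker f)) (e.trans e')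
      exact .of_equiv (e.trans e').symm
        ((hR'.isTwoPresented_ker_toSpanSingleton _ hprod.fst_of_prod).prod
          (ih hR' F' hprod.snd_of_prod))

end Matrix

section Resolution

open LinearMap (ker)

theorem HasFiniteNPresentation.of_le {R : Type u} [CommRing R] {E : Type u} [AddCommGroup E]
    [Module R E] {m n : ℕ} (hmn : m ≤ n) (h : HasFiniteNPresentation R E n) :
    HasFiniteNPresentation R E m := by
  obtain ⟨k, f, g, hg, h0, h1⟩ := h
  exact ⟨k, f, g, hg, fun h ↦ h0 (h.trans_le hmn), fun i hi ↦ h1 i (hi.trans_le hmn)⟩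

theorem HasFiniteNPresentation.of_finite {R : Type u} [CommRing R] {E : Type u} [AddCommGroup E]
    [Module R E] [Module.Finite R E] : HasFiniteNPresentation R E 0 := by
  obtain ⟨k, p, hp⟩ := Module.Finite.exists_fin' R E
  exact ⟨fun _ ↦ k, fun _ ↦ 0, p, hp, fun h ↦ absurd h (lt_irrefl 0), fun _ h ↦ by omega⟩

theorem HasFiniteNPresentation.of_ker {R : Type u} [CommRing R] {E : Type u} [AddCommGroup E]
    [Module R E] {l n : ℕ} (p : (Fin l → R) →ₗ[R] E) (hp : Function.Surjective p)
    (h : HasFiniteNPresentation R (ker p) n) : HasFiniteNPresentation R E (n + 1) := by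
  obtain ⟨k, f, g, hg, h0, h1⟩ := h
  let k' : ℕ → ℕ := fun i ↦ Nat.casesOn i l k
  let f' : ∀ i, (Fin (k' (i + 1)) → R) →ₗ[R] (Fin (k' i) → R) := fun i ↦
    match i with
    | 0 => (ker p).subtype ∘ₗ g
    | i + 1 => f i
  refine ⟨k', f', p, hp, fun _ ↦ ?_, fun i hi ↦ ?_⟩
  · change LinearMap.range ((ker p).subtype ∘ₗ g) = ker p
    rw [LinearMap.range_comp_of_range_eq_top _ (LinearMap.range_eq_top.mpr hg),
      Submodule.range_subtype]
  · cases i with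
    | zero =>
      change LinearMap.range (f 0) = ker ((ker p).subtype ∘ₗ g)
      rw [h0 (by omega), LinearMap.ker_comp_of_ker_eq_bot _ (Submodule.ker_subtype _)]
    | succ i => exact h1 i (by omega)

theorem HasFiniteNPresentation.of_range_eq {R : Type u} [CommRing R] {l n : ℕ} {E : Type u}
    [AddCommGroup E] [Module R E] {K : Submodule R E} (f : (Fin l → R) →ₗ[R] E)
    (hf : LinearMap.range f = K) (h : HasFiniteNPresentation R (ker f) n) :
    HasFiniteNPresentation R K (n + 1) := by
  subst hf
  refine .of_ker f.rangeRestrict f.surjective_rangeRestrict ?_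
  rwa [LinearMap.ker_rangeRestrict]

theorem IsArithmetic.locallyComparable {R : Type u} [CommRing R] (hR : IsArithmetic R) :
    LocallyComparable R := by
  intro a b
  let I := (Ideal.span {b}).colon {a}
  let J := (Ideal.span {a}).colon {b}
  have h1 : (1 : R) ∈ I ⊔ J := by
    rw [← Ideal.eq_top_iff_one]
    by_contra hne
    obtain ⟨P, hP, hle⟩ := Ideal.exists_le_maximal _ hne
    have := hP.isPrime
    have key : ∀ x y : R, Ideal.span {algebraMap R (Localization.AtPrime P) x} ≤
        Ideal.span {algebraMap R (Localization.AtPrime P) y} → ∃ s ∉ P, y ∣ s * x := by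
      intro x y hxy
      rw [Ideal.span_singleton_le_span_singleton] at hxy
      obtain ⟨c, hc⟩ := hxy
      obtain ⟨⟨c', s⟩, hs⟩ := IsLocalization.surj P.primeCompl c
      have : algebraMap R (Localization.AtPrime P) (s * x) = algebraMap R _ (y * c') := by
        rw [map_mul, map_mul, hc, ← hs]
        ring
      obtain ⟨t, ht⟩ := IsLocalization.exists_of_eq (M := P.primeCompl) this
      exact ⟨t * s, (t * s).2, t * c', by rw [mul_assoc, ht]; ring⟩
    rcases hR P hP (Ideal.span {algebraMap R _ a}) (Ideal.span {algebraMap R _ b}) with h | h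
    · obtain ⟨s, hs, hd⟩ := key a b h
      exact hs (hle (Ideal.mem_sup_left (by
        simpa [I, Submodule.mem_colon_singleton, Ideal.mem_span_singleton] using hd)))
    · obtain ⟨s, hs, hd⟩ := key b a h
      exact hs (hle (Ideal.mem_sup_right (by
        simpa [J, Submodule.mem_colon_singleton, Ideal.mem_span_singleton] using hd)))
  obtain ⟨t, ht, t', ht', htt⟩ := Submodule.mem_sup.mp h1
  refine ⟨t, ?_, ?_⟩
  · simpa [I, Submodule.mem_colon_singleton, Ideal.mem_span_singleton] using ht
  · rw [← htt, add_sub_cancel_left]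
    simpa [J, Submodule.mem_colon_singleton, Ideal.mem_span_singleton] using ht'

theorem LocallyComparable.fg_ker_of_exact {R : Type u} [CommRing R] (hR : LocallyComparable R)
    {k₀ k₁ k₂ k₃ : ℕ} (f₀ : (Fin k₁ → R) →ₗ[R] (Fin k₀ → R)) (f₁ : (Fin k₂ → R) →ₗ[R] (Fin k₁ → R))
    (f₂ : (Fin k₃ → R) →ₗ[R] (Fin k₂ → R)) (h₁ : LinearMap.range f₁ = ker f₀)
    (h₂ : LinearMap.range f₂ = ker f₁) : (ker f₂).FG := by
  have hfg : Module.Finite R (ker f₁) := by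
    rw [← h₂]
    infer_instance
  have h2 : IsTwoPresented R (ker f₀) := hR.isTwoPresented_ker f₀ <| by
    rw [← h₁]
    refine Module.finitePresentation_of_surjective f₁.rangeRestrict f₁.surjective_rangeRestrict ?_
    rwa [LinearMap.ker_rangeRestrict, ← Module.Finite.iff_fg]
  rw [← h₁] at h2
  have h3 := h2.2 k₂ f₁.rangeRestrict f₁.surjective_rangeRestrict
  rw [LinearMap.ker_rangeRestrict, ← h₂] at h3
  have := h3.fg_ker f₂.rangeRestrict f₂.surjective_rangeRestrict
  rwa [LinearMap.ker_rangeRestrict] at this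

end Resolution

/-- Every commutative arithmetic ring `R` has `λ`-dimension at most 3. -/
theorem lambdaDim_le_three_of_isArithmetic (R : Type u) [CommRing R]
    (hR : IsArithmetic R) : LambdaDimLE R 3 := by
  intro E _ _ hE m
  induction m generalizing E with
  | zero => exact hE.of_le (Nat.zero_le 3)
  | succ m ih =>
    obtain ⟨k, f, g, hg, h0, h1⟩ := hE
    have hfg := hR.locallyComparable.fg_ker_of_exact (f 0) (f 1) (f 2)
      (h1 0 (by omega)) (h1 1 (by omega))
    have : Module.Finite R (LinearMap.ker (f 2)) := Module.Finite.iff_fg.mpr hfg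
    exact .of_ker g hg (ih _ (.of_range_eq (f 0) (h0 (by omega))
      (.of_range_eq (f 1) (h1 0 (by omega)) (.of_range_eq (f 2) (h1 1 (by omega)) .of_finite))))
end

section
/- Every reduced commutative arithmetic ring R has λ-dimension at most 2. -/
open DirectSum

universe u

/-- A reduced ring whose ideals are totally ordered by inclusion is a domain as soon as it is
nontrivial. -/
theorem isDomain_of_ideal_le_total {A : Type*} [CommRing A] [Nontrivial A] [IsReduced A]
    (h : ∀ I J : Ideal A, I ≤ J ∨ J ≤ I) : IsDomain A := by
  have key : ∀ x y : A, x ∣ y → x * y = 0 → y = 0 := by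
    rintro x _ ⟨c, rfl⟩ hxy
    exact IsReduced.eq_zero _ ⟨2, by linear_combination c * hxy⟩
  have : NoZeroDivisors A := ⟨fun {a b} hab => by
    rcases h (Ideal.span {a}) (Ideal.span {b}) with h | h <;>
      rw [Ideal.span_singleton_le_span_singleton] at h
    · exact Or.inl (key b a h (by rwa [mul_comm]))
    · exact Or.inr (key a b h hab)⟩
  exact NoZeroDivisors.to_isDomain A

/-- Over a reduced arithmetic ring every submodule of a flat module is flat. -/
theorem IsArithmetic.flat_submodule {R : Type*} [CommRing R] [IsReduced R]
    (hR : IsArithmetic R) {M : Type*} [AddCommGroup M] [Module R M] [Module.Flat R M]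
    (N : Submodule R M) : Module.Flat R N := by
  refine Module.flat_of_localized_maximal _ fun P hP => ?_
  have hP' := hP.isPrime
  have hT : ∀ I J : Ideal (Localization P.primeCompl), I ≤ J ∨ J ≤ I := hR P hP
  have : Nontrivial (Localization P.primeCompl) :=
    inferInstanceAs (Nontrivial (Localization.AtPrime P))
  have : IsReduced (Localization P.primeCompl) :=
    isReduced_localizationPreserves P.primeCompl _ inferInstance
  have := isDomain_of_ideal_le_total hT
  have : PreValuationRing (Localization P.primeCompl) :=
    PreValuationRing.iff_ideal_total.mpr ⟨hT⟩
  have : ValuationRing (Localization P.primeCompl) := { }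
  rw [← Module.flat_iff_of_isLocalization (Localization P.primeCompl) P.primeCompl,
    Module.Flat.flat_iff_torsion_eq_bot_of_isBezout, ← Submodule.isTorsionFree_iff_torsion_eq_bot]
  exact (LocalizedModule.map_injective P.primeCompl N.subtype
    N.subtype_injective).moduleIsTorsionFree _ (map_smul _)

/-- A linear map between finite free modules whose range is projective has a kernel which is
the projective range of another such map. -/
theorem exists_range_eq_ker_of_projective_range {R : Type*} [CommRing R] {a b : ℕ}
    (h : (Fin a → R) →ₗ[R] (Fin b → R)) (hp : Module.Projective R (LinearMap.range h)) :
    ∃ (c : ℕ) (h' : (Fin c → R) →ₗ[R] (Fin a → R)),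
      LinearMap.range h' = LinearMap.ker h ∧ Module.Projective R (LinearMap.range h') := by
  obtain ⟨s, hs⟩ := h.rangeRestrict.exists_rightInverse_of_surjective h.range_rangeRestrict
  have hs' : ∀ y, h (s y) = y := fun y => congrArg Subtype.val (LinearMap.congr_fun hs y)
  let r : (Fin a → R) →ₗ[R] LinearMap.ker h :=
    (LinearMap.id - s ∘ₗ h.rangeRestrict).codRestrict _ fun x => by simp [hs']
  have hr : r ∘ₗ (LinearMap.ker h).subtype = LinearMap.id := by
    ext1 x
    have hx : h.rangeRestrict x = 0 := Subtype.ext x.2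
    apply Subtype.ext
    simp [r, hx]
  have hker : LinearMap.range ((LinearMap.ker h).subtype ∘ₗ r) = LinearMap.ker h := by
    rw [LinearMap.range_comp, LinearMap.range_eq_top.mpr, Submodule.map_top,
      Submodule.range_subtype]
    exact fun x => ⟨x, LinearMap.congr_fun hr x⟩
  refine ⟨a, _, hker, ?_⟩
  rw [hker]
  exact Module.Projective.of_split _ r hr

/-- A module with a finite `1`-presentation whose first syzygy is projective has finite
`m`-presentations for all `m`. -/
theorem hasFiniteNPresentation_of_projective_range {R E : Type u} [CommRing R] [AddCommGroup E]
    [Module R E] {a b : ℕ} (f : (Fin a → R) →ₗ[R] (Fin b → R)) (g : (Fin b → R) →ₗ[R] E)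
    (hg : Function.Surjective g) (hfg : LinearMap.range f = LinearMap.ker g)
    (hp : Module.Projective R (LinearMap.range f)) (m : ℕ) : HasFiniteNPresentation R E m := by
  choose c d hd hdp using @exists_range_eq_ker_of_projective_range R _
  let S := Σ' (a b : ℕ) (h : (Fin a → R) →ₗ[R] (Fin b → R)),
    Module.Projective R (LinearMap.range h)
  let s : ℕ → S := fun i =>
    Nat.rec ⟨a, b, f, hp⟩ (fun _ p => ⟨c p.2.2.1 p.2.2.2, p.1, d p.2.2.1 p.2.2.2, hdp _ _⟩) i
  exact ⟨fun i => (s i).2.1, fun i => (s i).2.2.1, g, hg, fun _ => hfg,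
    fun i _ => hd (s i).2.2.1 (s i).2.2.2⟩

/-- Every reduced commutative arithmetic ring has `λ`-dimension at most 2. -/
theorem lambdaDim_le_two_of_isArithmetic_of_isReduced (R : Type u) [CommRing R]
    [IsReduced R] (hR : IsArithmetic R) : LambdaDimLE R 2 := by
  intro E _ _ ⟨k, f, g, hg, hfg, hff⟩
  have hfg := hfg two_pos
  have hff := hff 0 one_lt_two
  have := hR.flat_submodule (LinearMap.range (f 0))
  have : Module.FinitePresentation R (LinearMap.range (f 0)) := by
    refine Module.finitePresentation_of_surjective _ (f 0).surjective_rangeRestrict ?_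
    rw [LinearMap.ker_rangeRestrict, ← hff]
    exact Module.Finite.iff_fg.mp inferInstance
  exact hasFiniteNPresentation_of_projective_range (f 0) g hg hfg
    Module.Flat.projective_of_finitePresentation
end

section
/- If R is a commutative arithmetic ring that is self fp-injective, then the λ-dimension of R is at most 2. -/
open DirectSum

universe u

open CategoryTheory in
/-- A vanishing first derived `Ext` group makes every cocycle on a projective resolution a
coboundary. -/
lemma exists_comp_eq_of_subsingleton_ext_one {R : Type u} [CommRing R] {F Y : ModuleCat.{u} R}
    (h : Subsingleton (((Ext R (ModuleCat.{u} R) 1).obj (Opposite.op F)).obj Y))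
    (P : ProjectiveResolution F) (χ : P.complex.X 1 ⟶ Y) (hχ : P.complex.d 2 1 ≫ χ = 0) :
    ∃ ω : P.complex.X 0 ⟶ Y, P.complex.d 1 0 ≫ ω = χ := by
  have hz : Limits.IsZero ((P.complex.linearYonedaObj R Y).homology 1) :=
    (ModuleCat.isZero_of_subsingleton _).of_iso (P.isoExt (R := R) 1 Y).symm
  rw [← HomologicalComplex.exactAt_iff_isZero_homology,
    HomologicalComplex.exactAt_iff' _ 0 1 2 (by simp) (by simp),
    ShortComplex.moduleCat_exact_iff] at hz
  exact hz χ hχ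

open CategoryTheory in
/-- If `Ext¹(F, Y) = 0`, then linear maps into `Y` extend from the kernel of any surjection of a
projective module onto `F`. -/
lemma exists_linearMap_extending_of_subsingleton_ext_one {R : Type u} [CommRing R]
    {F Y G : Type u} [AddCommGroup F] [Module R F] [AddCommGroup Y] [Module R Y]
    [AddCommGroup G] [Module R G] [Module.Projective R G]
    (h : Subsingleton (((Ext R (ModuleCat.{u} R) 1).obj
      (Opposite.op (ModuleCat.of R F))).obj (ModuleCat.of R Y)))
    (g : G →ₗ[R] F) (hg : Function.Surjective g) (φ : LinearMap.ker g →ₗ[R] Y) :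
    ∃ ψ : G →ₗ[R] Y, ∀ y : LinearMap.ker g, ψ y = φ y := by
  let P := projectiveResolution (ModuleCat.of R F)
  let π : P.complex.X 0 →ₗ[R] F := (P.π.f 0).hom
  let d : P.complex.X 1 →ₗ[R] P.complex.X 0 := (P.complex.d 1 0).hom
  have hπ : Function.Surjective π := (ModuleCat.epi_iff_surjective (P.π.f 0)).1 inferInstance
  have hex : ∀ x, π x = 0 → ∃ w, d w = x := (ShortComplex.moduleCat_exact_iff _).1 P.exact₀
  have hd : ∀ w, π (d w) = 0 := fun w =>
    congrArg (fun f => f.hom w) P.complex_d_comp_π_f_zero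
  have : Module.Projective R (P.complex.X 0) :=
    (IsProjective.iff_projective _).2 (P.projective 0)
  obtain ⟨u, hu⟩ := Module.projective_lifting_property g π hg
  obtain ⟨v, hv⟩ := Module.projective_lifting_property π g hπ
  replace hu : ∀ x, g (u x) = π x := fun x => LinearMap.congr_fun hu x
  replace hv : ∀ x, π (v x) = g x := fun x => LinearMap.congr_fun hv x
  let u' : P.complex.X 1 →ₗ[R] LinearMap.ker g :=
    (u ∘ₗ d).codRestrict _ fun w => by simp [hu, hd]
  obtain ⟨ω, hω⟩ := exists_comp_eq_of_subsingleton_ext_one h P (ModuleCat.ofHom (φ ∘ₗ u')) (by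
    ext w
    have h0 : d ((P.complex.d 2 1).hom w) = 0 :=
      congrArg (fun f => f.hom w) (P.complex.d_comp_d 2 1 0)
    have h1 : u' ((P.complex.d 2 1).hom w) = 0 := Subtype.ext (by simp [u', h0])
    simp [h1])
  let e : G →ₗ[R] LinearMap.ker g :=
    (LinearMap.id - u ∘ₗ v).codRestrict _ fun x => by simp [hu, hv]
  refine ⟨ω.hom ∘ₗ v + φ ∘ₗ e, fun y => ?_⟩
  obtain ⟨w, hw⟩ := hex (v y) (by rw [hv]; exact y.2)
  have h1 : ω.hom (v y) = φ (u' w) := by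
    rw [← hw]; exact congrArg (fun f => f.hom w) hω
  simp only [LinearMap.add_apply, LinearMap.comp_apply, h1, ← map_add]
  congr 1
  ext
  simp [u', e, hw]

/-- Over a self fp-injective ring, dualizing preserves exactness in the middle of a sequence of
finitely generated free modules. -/
lemma SelfFPInjective.exists_comp_eq {R : Type u} [CommRing R] (hinj : SelfFPInjective R)
    {n m : ℕ} (A : (Fin n → R) →ₗ[R] (Fin m → R)) (φ : (Fin n → R) →ₗ[R] R)
    (hφ : LinearMap.ker A ≤ LinearMap.ker φ) : ∃ ψ : (Fin m → R) →ₗ[R] R, ψ ∘ₗ A = φ := by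
  let g := (LinearMap.range A).mkQ
  have hfp : Module.FinitePresentation R ((Fin m → R) ⧸ LinearMap.range A) :=
    Module.finitePresentation_of_surjective g (Submodule.mkQ_surjective _)
      (by rw [Submodule.ker_mkQ, LinearMap.range_eq_map]; exact Module.Finite.fg_top.map A)
  have hker : LinearMap.ker g = LinearMap.range A := Submodule.ker_mkQ _
  let φ' : LinearMap.range A →ₗ[R] R :=
    (LinearMap.ker A).liftQ φ hφ ∘ₗ A.quotKerEquivRange.symm.toLinearMap
  obtain ⟨ψ, hψ⟩ := exists_linearMap_extending_of_subsingleton_ext_one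
    (hinj (ModuleCat.of R ((Fin m → R) ⧸ LinearMap.range A)) hfp) g (Submodule.mkQ_surjective _)
    (φ' ∘ₗ (LinearEquiv.ofEq _ _ hker).toLinearMap)
  refine ⟨ψ, LinearMap.ext fun x => ?_⟩
  have hx : A x ∈ LinearMap.ker g := by
    rw [hker]; exact LinearMap.mem_range_self A x
  have h2 : A.quotKerEquivRange.symm ⟨A x, LinearMap.mem_range_self A x⟩ =
      (LinearMap.ker A).mkQ x := by
    rw [LinearEquiv.symm_apply_eq]
    exact Subtype.ext (by simp)
  have h3 := hψ ⟨A x, hx⟩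
  simp only [LinearMap.comp_apply, φ'] at h3 ⊢
  rw [h3]
  exact (congrArg ((LinearMap.ker A).liftQ φ hφ) h2).trans (by simp)

/-- In an arithmetic ring, divisibility is total up to a factor outside a given maximal ideal. -/
lemma IsArithmetic.exists_dvd_mul_or_dvd_mul {R : Type u} [CommRing R] (hR : IsArithmetic R)
    {M : Ideal R} (hM : M.IsMaximal) (a b : R) :
    (∃ s, s ∉ M ∧ a ∣ s * b) ∨ ∃ s, s ∉ M ∧ b ∣ s * a := by
  have := hM.isPrime
  have key : ∀ a b : R, Ideal.span {algebraMap R (Localization.AtPrime M) a} ≤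
      Ideal.span {algebraMap R (Localization.AtPrime M) b} → ∃ s, s ∉ M ∧ b ∣ s * a := by
    intro a b h
    rw [Ideal.span_singleton_le_span_singleton] at h
    obtain ⟨c, hc⟩ := h
    obtain ⟨⟨x, y⟩, hxy⟩ := IsLocalization.surj M.primeCompl c
    have h1 : algebraMap R (Localization.AtPrime M) (y * a) = algebraMap R _ (b * x) := by
      rw [map_mul, map_mul, hc, ← hxy]; ring
    obtain ⟨t, ht⟩ := (IsLocalization.eq_iff_exists M.primeCompl _).1 h1
    exact ⟨t * y, (t * y).2, t * x, by linear_combination ht⟩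
  exact (hR M hM _ _).symm.imp (key b a) (key a b)

/-- In an arithmetic ring, any nonempty finite family has a member dividing all the others up to
a factor outside a given maximal ideal. -/
lemma IsArithmetic.exists_forall_dvd_mul {R : Type u} [CommRing R] (hR : IsArithmetic R)
    {M : Ideal R} (hM : M.IsMaximal) {ι : Type*} [Fintype ι] [Nonempty ι] (a : ι → R) :
    ∃ i, ∃ s, s ∉ M ∧ ∀ j, a i ∣ s * a j := by
  have hP := hM.isPrime
  let r : R → R → Prop := fun x y => ∃ s, s ∉ M ∧ y ∣ s * x
  have : IsTrans R r := ⟨fun x y z ⟨s, hs, hs'⟩ ⟨t, ht, ht'⟩ =>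
    ⟨t * s, hP.mul_notMem ht hs, ht'.trans (by rw [mul_assoc]; exact mul_dvd_mul_left t hs')⟩⟩
  have h1 : (1 : R) ∉ M := M.ne_top_iff_one.1 hM.ne_top
  have hdir : Directed r a := fun i j => by
    rcases hR.exists_dvd_mul_or_dvd_mul hM (a i) (a j) with h | h
    · exact ⟨i, ⟨1, h1, by simp⟩, h⟩
    · exact ⟨j, h, ⟨1, h1, by simp⟩⟩
  obtain ⟨i, hi⟩ := hdir.finset_le Finset.univ
  choose s hs hdvd using fun j => hi j (Finset.mem_univ j)
  classical
  refine ⟨i, ∏ j, s j, fun h => ?_, fun j => ?_⟩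
  · obtain ⟨j, -, hj⟩ := (hP.prod_mem_iff).1 h
    exact hs j hj
  · exact (hdvd j).trans (mul_dvd_mul_right (Finset.dvd_prod_of_mem s (Finset.mem_univ j)) _)

/-- A linear map on a finite power of the ring is determined by the images of the standard basis
vectors. -/
lemma LinearMap.apply_eq_sum_smul_single {R V ι : Type*} [CommRing R] [AddCommGroup V]
    [Module R V] [Fintype ι] [DecidableEq ι] (f : (ι → R) →ₗ[R] V) (x : ι → R) :
    f x = ∑ i, x i • f (Pi.single i 1) := by
  conv_lhs => rw [pi_eq_sum_univ' x]
  simp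

/-- A diagonalization of a linear map `A` up to the scalar `s`: vectors `q i` and functionals
`p i` forming a basis and its dual up to `s`, such that `A` is given by the scalars `d i`. -/
structure ScaledDiagonalization {R : Type u} [CommRing R] {F G : Type u} [AddCommGroup F]
    [Module R F] [AddCommGroup G] [Module R G] (A : F →ₗ[R] G) (s : R) where
  ι : Type
  [fintype : Fintype ι]
  p : ι → F →ₗ[R] R
  q : ι → F
  d : ι → R
  r : ι → G
  ρ : ι → G →ₗ[R] R
  sum_smul : ∀ x, ∑ i, p i x • q i = s • x
  apply_self : ∀ i, p i (q i) = s
  map_q : ∀ i, A (q i) = d i • r i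
  ρ_map : ∀ i x, ρ i (A x) = d i * p i x

attribute [instance] ScaledDiagonalization.fintype

/-- Matrices over an arithmetic ring can be diagonalized up to a factor outside a given maximal
ideal. -/
lemma IsArithmetic.exists_scaledDiagonalization {R : Type u} [CommRing R] (hR : IsArithmetic R)
    {M : Ideal R} (hM : M.IsMaximal) {n m : ℕ} (A : (Fin n → R) →ₗ[R] (Fin m → R)) :
    ∃ s, s ∉ M ∧ Nonempty (ScaledDiagonalization A s) := by
  have hP := hM.isPrime
  induction n with
  | zero =>
    refine ⟨1, M.ne_top_iff_one.1 hM.ne_top, ⟨{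
      ι := Empty
      p := Empty.elim
      q := Empty.elim
      d := Empty.elim
      r := Empty.elim
      ρ := Empty.elim
      sum_smul := fun x => Subsingleton.elim _ _
      apply_self := fun i => i.elim
      map_q := fun i => i.elim
      ρ_map := fun i => i.elim }⟩⟩
  | succ n ih =>
    rcases isEmpty_or_nonempty (Fin m) with hm | hm
    · refine ⟨1, M.ne_top_iff_one.1 hM.ne_top, ⟨{
        ι := Fin (n + 1)
        p := LinearMap.proj
        q := fun i => Pi.single i 1
        d := 0
        r := 0
        ρ := 0
        sum_smul := fun x => by
          ext j; simp [Finset.sum_apply, Pi.single_apply]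
        apply_self := fun i => by simp
        map_q := fun i => Subsingleton.elim _ _
        ρ_map := fun i x => by simp }⟩⟩
    obtain ⟨⟨k, l⟩, s, hs, hdvd⟩ := hR.exists_forall_dvd_mul hM
      (fun kl : Fin m × Fin (n + 1) => A (Pi.single kl.2 1) kl.1)
    set a := A (Pi.single l 1) k with ha
    choose c hc using fun i j => hdvd (i, j)
    simp only at hc
    let pl : (Fin (n + 1) → R) →ₗ[R] R :=
      s • LinearMap.proj l + ∑ j, c k (l.succAbove j) • LinearMap.proj (l.succAbove j)
    let σ : (Fin (n + 1) → R) →ₗ[R] (Fin n → R) := LinearMap.funLeft R R l.succAbove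
    let τ : (Fin n → R) →ₗ[R] (Fin (n + 1) → R) :=
      { toFun := fun y => l.insertNth (-∑ j, c k (l.succAbove j) * y j) (s • y)
        map_add' := fun y z => by
          ext i
          refine Fin.succAboveCases l ?_ (fun j => ?_) i <;>
            simp [mul_add, Finset.sum_add_distrib, add_comm]
        map_smul' := fun t y => by
          ext i
          refine Fin.succAboveCases l ?_ (fun j => ?_) i <;>
            simp [Finset.mul_sum, mul_left_comm] }
    have hστ : ∀ y, σ (τ y) = s • y := fun y => by
      ext j; simp [σ, τ, LinearMap.funLeft_apply]
    have hτσ : ∀ x, τ (σ x) = s • x - pl x • Pi.single l 1 := fun x => by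
      ext i
      refine Fin.succAboveCases l ?_ (fun j => ?_) i <;>
        simp [σ, τ, pl, LinearMap.funLeft_apply]
    have hpl : ∀ x, s * A x k = a * pl x := fun x => by
      rw [A.apply_eq_sum_smul_single x, Finset.sum_apply, Fin.sum_univ_succAbove _ l]
      simp only [pl, Pi.smul_apply, smul_eq_mul, LinearMap.add_apply, LinearMap.smul_apply,
        LinearMap.proj_apply, LinearMap.sum_apply, mul_add, Finset.mul_sum]
      congr 1
      · rw [ha]; ring
      · refine Finset.sum_congr rfl fun j _ => ?_
        linear_combination x (l.succAbove j) * hc k (l.succAbove j)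
    have hcol : s • A (Pi.single l 1) = a • fun i => c i l := by
      ext i; simpa using hc i l
    obtain ⟨s', hs', ⟨D⟩⟩ := ih (A ∘ₗ τ)
    refine ⟨s ^ 2 * s', hP.mul_notMem (fun h => hs (hP.mem_of_pow_mem 2 h)) hs', ⟨{
      ι := Option D.ι
      p := fun o => o.elim (s' • pl) fun i => s • D.p i ∘ₗ σ
      q := fun o => o.elim (s • Pi.single l 1) fun i => τ (D.q i)
      d := fun o => o.elim a D.d
      r := fun o => o.elim (fun i => c i l) D.r
      ρ := fun o => o.elim ((s' * s) • LinearMap.proj k) fun i =>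
        s ^ 2 • D.ρ i - (D.ρ i fun i => c i l) • (s • LinearMap.proj k)
      sum_smul := ?_
      apply_self := ?_
      map_q := ?_
      ρ_map := ?_ }⟩⟩
    · intro x
      have h := congrArg τ (D.sum_smul (σ x))
      simp only [map_sum, map_smul, hτσ] at h
      simp only [Fintype.sum_option, Option.elim, LinearMap.smul_apply, LinearMap.comp_apply,
        smul_assoc, ← Finset.smul_sum, h]
      module
    · rintro (_ | i)
      · simp [pl]; ring
      · have h := D.apply_self i
        simp [hστ, h]; ring
    · rintro (_ | i)
      · simpa using hcol
      · exact D.map_q i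
    · rintro (_ | i) x
      · have := hpl x
        simp
        linear_combination s' * this
      · have h := D.ρ_map i (σ x)
        have hx := hpl x
        have h2 := congrArg (D.ρ i) hcol
        simp only [LinearMap.comp_apply, hτσ, map_sub, map_smul, smul_eq_mul] at h h2
        simp
        linear_combination s * h + pl x * h2 - (D.ρ i fun i => c i l) * hx

/-- A submodule which is finitely generated up to a factor outside each maximal ideal is finitely
generated. -/
lemma Submodule.fg_of_forall_isMaximal_exists_smul_le {R : Type u} [CommRing R] {V : Type u}
    [AddCommGroup V] [Module R V] (K : Submodule R V)
    (h : ∀ M : Ideal R, M.IsMaximal →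
      ∃ t, t ∉ M ∧ ∃ N : Submodule R V, N.FG ∧ N ≤ K ∧ ∀ z ∈ K, t • z ∈ N) : K.FG := by
  let J : Ideal R :=
    { carrier := {t | ∃ N : Submodule R V, N.FG ∧ N ≤ K ∧ ∀ z ∈ K, t • z ∈ N}
      zero_mem' := ⟨⊥, Submodule.fg_bot, bot_le, fun z _ => by simp⟩
      add_mem' := by
        rintro t t' ⟨N, hN, hNK, hz⟩ ⟨N', hN', hNK', hz'⟩
        refine ⟨N ⊔ N', hN.sup hN', sup_le hNK hNK', fun z hzK => ?_⟩
        rw [add_smul]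
        exact Submodule.add_mem_sup (hz z hzK) (hz' z hzK)
      smul_mem' := by
        rintro c t ⟨N, hN, hNK, hz⟩
        refine ⟨N, hN, hNK, fun z hzK => ?_⟩
        rw [smul_eq_mul, mul_smul]
        exact N.smul_mem c (hz z hzK) }
  have hJ : J = ⊤ := by
    by_contra hne
    obtain ⟨M, hM, hJM⟩ := J.exists_le_maximal hne
    obtain ⟨t, ht, htJ⟩ := h M hM
    exact ht (hJM htJ)
  obtain ⟨N, hN, hNK, hz⟩ : (1 : R) ∈ J := hJ ▸ Submodule.mem_top
  have : N = K := le_antisymm hNK fun z hzK => by simpa using hz z hzK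
  exact this ▸ hN

/-- Over an arithmetic self fp-injective ring, a map of finitely generated free modules whose
image is the kernel of another such map has finitely generated kernel. -/
lemma fg_ker_of_range_eq_ker {R : Type u} [CommRing R] (hR : IsArithmetic R)
    (hinj : SelfFPInjective R) {l n m : ℕ} (A : (Fin n → R) →ₗ[R] (Fin m → R))
    (B : (Fin l → R) →ₗ[R] (Fin n → R)) (hAB : LinearMap.range B = LinearMap.ker A) :
    (LinearMap.ker B).FG := by
  refine Submodule.fg_of_forall_isMaximal_exists_smul_le _ fun M hM => ?_
  have hP := hM.isPrime
  obtain ⟨s, hs, ⟨D⟩⟩ := hR.exists_scaledDiagonalization hM A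
  have hABz : ∀ z, A (B z) = 0 := fun z =>
    LinearMap.mem_ker.1 (hAB ▸ LinearMap.mem_range_self B z)
  -- a local generator `b i` of the ideal of values of `p i` on the range of `B`
  have hb : ∀ i, ∃ b t, t ∉ M ∧ D.d i * b = 0 ∧ ∃ β : (Fin l → R) →ₗ[R] R,
      ∀ z, t * D.p i (B z) = b * β z := by
    intro i
    obtain ⟨o, t, ht, hdvd⟩ := hR.exists_forall_dvd_mul hM
      (fun o : Option (Fin l) => o.elim 0 fun j => D.p i (B (Pi.single j 1)))
    choose c hc using fun j => hdvd (some j)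
    refine ⟨o.elim 0 fun j => D.p i (B (Pi.single j 1)), t, ht, ?_,
      Fintype.linearCombination R c, fun z => ?_⟩
    · rcases o with _ | j
      · simp
      · simp [← D.ρ_map, hABz]
    · conv_lhs => rw [B.apply_eq_sum_smul_single z]
      simp only [map_sum, map_smul, Finset.mul_sum, Fintype.linearCombination_apply,
        smul_eq_mul]
      refine Finset.sum_congr rfl fun j _ => ?_
      have h := hc j
      rw [Option.elim_some] at h
      linear_combination z j * h
  choose b t₀ ht₀ hdb β₀ hβ₀ using hb
  classical
  obtain ⟨t, ht, β, hβ⟩ : ∃ t, t ∉ M ∧ ∃ β : D.ι → (Fin l → R) →ₗ[R] R,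
      ∀ i z, t * D.p i (B z) = b i * β i z := by
    refine ⟨∏ i, t₀ i, fun h => ?_, fun i => (∏ j ∈ Finset.univ.erase i, t₀ j) • β₀ i,
      fun i z => ?_⟩
    · obtain ⟨j, -, hj⟩ := (hP.prod_mem_iff).1 h
      exact ht₀ j hj
    · rw [← Finset.mul_prod_erase _ _ (Finset.mem_univ i)]
      simp only [LinearMap.smul_apply, smul_eq_mul]
      linear_combination (∏ j ∈ Finset.univ.erase i, t₀ j) * hβ₀ i z
  have hg : ∀ i, ∃ g, B g = b i • D.q i := fun i => by
    rw [← LinearMap.mem_range, hAB, LinearMap.mem_ker, map_smul, D.map_q, smul_smul, mul_comm,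
      hdb, zero_smul]
  choose g hg using hg
  -- the annihilator of `b i` is generated by `d i` up to a factor
  have hann : ∀ i c, b i * c = 0 → ∃ e, t * s * c = e * D.d i := by
    intro i c hc
    obtain ⟨ψ, hψ⟩ := hinj.exists_comp_eq A ((t * c) • D.p i) (by
      rw [← hAB]
      rintro _ ⟨z, rfl⟩
      rw [LinearMap.mem_ker, LinearMap.smul_apply, smul_eq_mul]
      linear_combination c * hβ i z + β i z * hc)
    have h := LinearMap.congr_fun hψ (D.q i)
    simp only [LinearMap.comp_apply, D.map_q, map_smul, LinearMap.smul_apply, D.apply_self,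
      smul_eq_mul] at h
    exact ⟨ψ (D.r i), by linear_combination -h⟩
  let H : (Fin l → R) →ₗ[R] (Fin l → R) :=
    (t * s) • LinearMap.id - ∑ i, (β i).smulRight (g i)
  have hH : ∀ z, H z = (t * s) • z - ∑ i, β i z • g i := fun z => by simp [H]
  have hBH : ∀ z, B (H z) = 0 := fun z => by
    have h := congrArg (t • ·) (D.sum_smul (B z))
    simp only [Finset.smul_sum, smul_smul, hβ] at h
    simp only [hH, map_sub, map_smul, map_sum, hg, smul_smul, ← h,
      mul_comm (β _ z), sub_self]
  refine ⟨t * s * (t * s), hP.mul_notMem (hP.mul_notMem ht hs) (hP.mul_notMem ht hs),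
    LinearMap.range H ⊔ Submodule.span R (Set.range fun i => D.d i • g i), ?_, ?_, ?_⟩
  · refine Submodule.FG.sup ?_ (Submodule.fg_span (Set.finite_range _))
    rw [LinearMap.range_eq_map]
    exact Module.Finite.fg_top.map H
  · refine sup_le ?_ (Submodule.span_le.2 ?_)
    · rintro _ ⟨z, rfl⟩
      exact hBH z
    · rintro _ ⟨i, rfl⟩
      simp [hg, smul_smul, hdb]
  · intro z hz
    have hz' : B z = 0 := hz
    choose e he using fun i => hann i (β i z) (by rw [← hβ, hz']; simp)
    have h : (t * s * (t * s)) • z = H ((t * s) • z) + ∑ i, e i • D.d i • g i := by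
      simp only [hH, map_smul, smul_smul, smul_eq_mul, he, sub_add_cancel]
    rw [h]
    exact Submodule.add_mem_sup (LinearMap.mem_range_self _ _)
      (Submodule.sum_mem _ fun i _ => Submodule.smul_mem _ _ (Submodule.subset_span ⟨i, rfl⟩))

/-- An exact sequence `R ^ c → R ^ b → R ^ a`. -/
structure FreeExactPair (R : Type u) [CommRing R] where
  a : ℕ
  b : ℕ
  c : ℕ
  A : (Fin b → R) →ₗ[R] (Fin a → R)
  B : (Fin c → R) →ₗ[R] (Fin b → R)
  exact : LinearMap.range B = LinearMap.ker A

/-- If the kernel of `B` is always finitely generated, an exact pair can be prolonged to the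
left. -/
lemma FreeExactPair.exists_prolongation {R : Type u} [CommRing R] (S : FreeExactPair R)
    (h : (LinearMap.ker S.B).FG) :
    ∃ (d : ℕ) (C : (Fin d → R) →ₗ[R] (Fin S.c → R)), LinearMap.range C = LinearMap.ker S.B := by
  obtain ⟨d, v, hv⟩ := Submodule.fg_iff_exists_fin_generating_family.1 h
  exact ⟨d, Fintype.linearCombination R v, by rw [Fintype.range_linearCombination, hv]⟩

/-- A commutative arithmetic self fp-injective ring has `λ`-dimension at most 2. -/
theorem lambdaDim_le_two_of_isArithmetic_of_selfFPInjective (R : Type u) [CommRing R]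
    (hR : IsArithmetic R) (hinj : SelfFPInjective R) : LambdaDimLE R 2 := by
  intro E _ _ ⟨k, f, g, hg, h0, h1⟩ m
  choose d C hC using fun S : FreeExactPair R =>
    S.exists_prolongation (fg_ker_of_range_eq_ker hR hinj S.A S.B S.exact)
  let S : ℕ → FreeExactPair R := fun i =>
    Nat.rec ⟨k 0, k 1, k 2, f 0, f 1, h1 0 (by norm_num)⟩
      (fun _ T => ⟨T.b, T.c, d T, T.B, C T, hC T⟩) i
  exact ⟨fun i => (S i).a, fun i => (S i).A, g, hg, fun _ => h0 (by norm_num),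
    fun i _ => (S i).exact⟩
end

section
/- A reduced commutative ring R is self fp-injective if and only if R is a von Neumann regular ring. -/
open DirectSum

universe u

open CategoryTheory in
/-- If `Ext¹(X, Y) = 0`, every `1`-cocycle of `Hom(P, Y)` is a coboundary, for any projective
resolution `P` of `X`. -/
theorem CategoryTheory.ProjectiveResolution.exists_d_comp_eq_of_subsingleton_Ext_one
    {R C : Type*} [Ring R] [Category* C] [Abelian C] [Linear R C] [EnoughProjectives C]
    {X Y : C} (P : ProjectiveResolution X)
    (hE : Subsingleton (((Ext R C 1).obj (Opposite.op X)).obj Y))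
    (f : P.complex.X 1 ⟶ Y) (hf : P.complex.d 2 1 ≫ f = 0) :
    ∃ g : P.complex.X 0 ⟶ Y, P.complex.d 1 0 ≫ g = f := by
  have hZ := (ModuleCat.isZero_of_subsingleton _).of_iso (P.isoExt (R := R) 1 Y).symm
  rw [← HomologicalComplex.exactAt_iff_isZero_homology,
    HomologicalComplex.exactAt_iff' _ 0 1 2 (by simp) (by simp),
    ShortComplex.moduleCat_exact_iff] at hZ
  exact hZ f hf

open CategoryTheory in
/-- If `Ext¹(M ⧸ N, Y) = 0` with `M` projective, linear maps `N → Y` extend to `M`. -/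
theorem Submodule.exists_extend_of_subsingleton_Ext_one {R M Y : Type u} [CommRing R]
    [AddCommGroup M] [Module R M] [Module.Projective R M] [AddCommGroup Y] [Module R Y]
    (N : Submodule R M)
    (hE : Subsingleton (((Ext R (ModuleCat.{u} R) 1).obj
      (Opposite.op (ModuleCat.of R (M ⧸ N)))).obj (ModuleCat.of R Y)))
    (h : N →ₗ[R] Y) : ∃ g : M →ₗ[R] Y, ∀ x : N, g x = h x := by
  let P := projectiveResolution (ModuleCat.of R (M ⧸ N))
  let π : P.complex.X 0 ⟶ ModuleCat.of R (M ⧸ N) := P.π.f 0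
  have hπ : Function.Surjective π := (ModuleCat.epi_iff_surjective π).1
    (inferInstanceAs (Epi (P.π.f 0)))
  have hexact : ∀ x, π x = 0 → ∃ y, P.complex.d 1 0 y = x :=
    (ShortComplex.moduleCat_exact_iff _).1 P.exact₀
  have hdπ (y) : π (P.complex.d 1 0 y) = 0 :=
    ConcreteCategory.congr_hom P.complex_d_comp_π_f_zero y
  have : Module.Projective R (P.complex.X 0) :=
    (IsProjective.iff_projective _).2 (P.projective 0)
  obtain ⟨φ, hφ⟩ := Module.projective_lifting_property N.mkQ π.hom N.mkQ_surjective
  obtain ⟨ψ, hψ⟩ := Module.projective_lifting_property π.hom N.mkQ hπ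
  have hφ' (x) : N.mkQ (φ x) = π x := LinearMap.congr_fun hφ x
  have hψ' (x) : π (ψ x) = N.mkQ x := LinearMap.congr_fun hψ x
  let φ₁ : P.complex.X 1 →ₗ[R] N := (φ ∘ₗ (P.complex.d 1 0).hom).codRestrict N fun y ↦
    (Submodule.Quotient.mk_eq_zero N).1 ((hφ' _).trans (hdπ y))
  obtain ⟨g, hg⟩ := P.exists_d_comp_eq_of_subsingleton_Ext_one hE (ModuleCat.ofHom (h ∘ₗ φ₁)) (by
    ext y
    have hdd : P.complex.d 1 0 (P.complex.d 2 1 y) = 0 := by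
      rw [← ConcreteCategory.comp_apply, P.complex.d_comp_d]; rfl
    have : φ₁ (P.complex.d 2 1 y) = 0 := Subtype.ext <| by
      change φ (P.complex.d 1 0 (P.complex.d 2 1 y)) = 0
      rw [hdd, map_zero]
    change h (φ₁ (P.complex.d 2 1 y)) = 0
    rw [this, map_zero])
  have hg' (y) : g.hom (P.complex.d 1 0 y) = h (φ₁ y) := ConcreteCategory.congr_hom hg y
  let ρ : M →ₗ[R] N := (LinearMap.id - φ ∘ₗ ψ).codRestrict N fun x ↦
    (Submodule.Quotient.eq N).1 ((hφ' _).trans (hψ' x)).symm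
  refine ⟨g.hom ∘ₗ ψ + h ∘ₗ ρ, fun x ↦ ?_⟩
  obtain ⟨y, hy⟩ := hexact (ψ x) (by rw [hψ']; simp)
  have hρ : ρ x = x - φ₁ y := Subtype.ext <| by
    change (x : M) - φ (ψ x) = x - φ (P.complex.d 1 0 y)
    rw [hy]
  change g.hom (ψ x) + h (ρ x) = h x
  rw [← hy, hg', hρ, map_sub, add_sub_cancel]

/-- A linear map out of a principal ideal `(b)` sending `b` to `a`, when `Ann b ⊆ Ann a`. -/
theorem Ideal.exists_linearMap_span_singleton {R : Type*} [CommRing R] (a b : R)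
    (hab : ∀ c, c * b = 0 → c * a = 0) :
    ∃ h : Ideal.span {b} →ₗ[R] R, h ⟨b, Ideal.mem_span_singleton_self b⟩ = a := by
  have key (x : Ideal.span {b}) : ∃ c, c * b = x := Ideal.mem_span_singleton'.1 x.2
  choose c hc using key
  have uniq (x : Ideal.span {b}) (d : R) (hd : d * b = x) : c x * a = d * a := by
    rw [← sub_eq_zero, ← sub_mul]
    exact hab _ (by rw [sub_mul, hc, hd, sub_self])
  refine ⟨{ toFun x := c x * a, map_add' x y := ?_, map_smul' r x := ?_ }, ?_⟩
  · rw [uniq (x + y) (c x + c y) (by simp [add_mul, hc]), add_mul]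
  · rw [uniq (r • x) (r * c x) (by simp [mul_assoc, hc]), mul_assoc]; rfl
  · exact (uniq _ 1 (one_mul b)).trans (one_mul a)

/-- Every module over a von Neumann regular ring is flat. -/
theorem Module.Flat.of_forall_exists_sq_mul_eq {R : Type*} [CommRing R]
    (hR : ∀ r : R, ∃ s : R, r ^ 2 * s = r) (M : Type*) [AddCommGroup M] [Module R M] :
    Module.Flat R M := by
  rw [Module.Flat.iff_rTensor_injective]
  intro I hI
  obtain ⟨e, he, rfl⟩ := (Ideal.isIdempotentElem_iff_of_fg I hI).1 <|
    le_antisymm Ideal.mul_le_left fun r hr ↦ by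
      obtain ⟨s, hs⟩ := hR r
      rw [← hs, sq, mul_assoc]
      exact Ideal.mul_mem_mul hr (Ideal.mul_mem_right s I hr)
  let p : R →ₗ[R] Ideal.span {e} :=
    (LinearMap.mulLeft R e).codRestrict _ fun x ↦
      Ideal.mul_mem_right x _ (Ideal.mem_span_singleton_self e)
  have hp : p ∘ₗ (Ideal.span {e}).subtype = LinearMap.id := by
    ext x
    obtain ⟨c, hc⟩ := Ideal.mem_span_singleton'.1 x.2
    change e * (x : R) = x
    rw [← hc, mul_left_comm, he.eq]
  refine Function.LeftInverse.injective (g := p.rTensor M) fun z ↦ ?_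
  rw [← LinearMap.comp_apply, ← LinearMap.rTensor_comp]
  simp [hp]

/-- A reduced commutative ring is self fp-injective iff it is
von Neumann regular, i.e. for every `r` there is `s` with `r² s = r`. -/
theorem selfFPInjective_iff_vonNeumannRegular_of_isReduced (R : Type u) [CommRing R]
    [IsReduced R] : SelfFPInjective R ↔ ∀ r : R, ∃ s : R, r ^ 2 * s = r := by
  refine ⟨fun hR r ↦ ?_, fun hR F _ ↦ ?_⟩
  · obtain ⟨h, hh⟩ := Ideal.exists_linearMap_span_singleton r (r ^ 2) fun c hc ↦
      eq_zero_of_pow_eq_zero (n := 2) (by rw [mul_pow, sq c, mul_assoc, hc, mul_zero])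
    obtain ⟨g, hg⟩ := Submodule.exists_extend_of_subsingleton_Ext_one (Ideal.span {r ^ 2})
      (hR _ (Module.finitePresentation_of_surjective _ (Submodule.mkQ_surjective _)
        (by rw [Submodule.ker_mkQ]; exact ⟨{r ^ 2}, by simp⟩))) h
    refine ⟨g 1, ?_⟩
    rw [← smul_eq_mul, ← map_smul, smul_eq_mul, mul_one]
    exact (hg ⟨r ^ 2, Ideal.mem_span_singleton_self _⟩).trans hh
  · have := Module.Flat.of_forall_exists_sq_mul_eq hR F
    have := Module.Flat.projective_of_finitePresentation (R := R) (M := F)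
    have := (IsProjective.iff_projective (R := R) F).1 this
    exact ModuleCat.subsingleton_of_isZero (isZero_Ext_succ_of_projective F _ 0)
end

section
/- Let R be a valuation ring with maximal ideal M and let Z be the set of zero-divisors of R. Then M is a flat R-module if and only if for every nonzero r ∈ Z the annihilator ideal (0 : r) = {x ∈ R | xr = 0} is not finitely generated. -/
open DirectSum

universe u

open TensorProduct in
/-- Over a Bézout ring, flatness only needs to be tested on principal ideals: `E` is flat iff
every `m : E` killed by `r` lies in `(0 : r) • E`. -/
theorem flat_iff_mem_torsionOf_smul_top {R E : Type*} [CommRing R] [IsBezout R]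
    [AddCommGroup E] [Module R E] :
    Module.Flat R E ↔
      ∀ (r : R) (m : E), r • m = 0 → m ∈ Ideal.torsionOf R R r • (⊤ : Submodule R E) := by
  constructor
  · intro _ r m h
    obtain ⟨k, a, y, hm, ha⟩ := Module.Flat.isTrivialRelation_of_sum_smul_eq_zero
      (f := fun _ : Fin 1 ↦ r) (x := fun _ ↦ m) (by simpa using h)
    rw [show m = _ from hm 0]
    refine Submodule.sum_mem _ fun j _ ↦ Submodule.smul_mem_smul ?_ trivial
    simpa [Ideal.mem_torsionOf_iff, mul_comm] using ha j
  · intro h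
    refine Module.Flat.iff_lift_lsmul_comp_subtype_injective.mpr fun I hI ↦ ?_
    obtain ⟨d, rfl⟩ := (IsBezout.isPrincipal_of_FG I hI).principal
    let d' : Submodule.span R {d} := ⟨d, Submodule.mem_span_singleton_self d⟩
    have pure_of (t : Submodule.span R {d} ⊗[R] E) : ∃ m : E, t = d' ⊗ₜ m := by
      induction t with
      | zero => exact ⟨0, by simp⟩
      | tmul x m =>
        obtain ⟨x, hx⟩ := x
        obtain ⟨c, rfl⟩ := Submodule.mem_span_singleton.mp hx
        exact ⟨c • m, TensorProduct.smul_tmul c d' m⟩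
      | add s t hs ht =>
        obtain ⟨m, rfl⟩ := hs
        obtain ⟨n, rfl⟩ := ht
        exact ⟨m + n, (TensorProduct.tmul_add _ _ _).symm⟩
    refine (injective_iff_map_eq_zero _).mpr fun t ht ↦ ?_
    obtain ⟨m, rfl⟩ := pure_of t
    have hm : m ∈ Ideal.torsionOf R R d • (⊤ : Submodule R E) := h d m (by simpa using ht)
    clear ht
    induction hm using Submodule.smul_induction_on' with
    | smul c hc n _ =>
      have hcd : c • d' = 0 := Subtype.ext hc
      rw [← TensorProduct.smul_tmul, hcd, TensorProduct.zero_tmul]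
    | add x _ y _ hx hy => rw [TensorProduct.tmul_add, hx, hy, add_zero]

theorem isBezout_of_ideal_total {R : Type*} [CommRing R]
    (hval : ∀ I J : Ideal R, I ≤ J ∨ J ≤ I) : IsBezout R := by
  refine IsBezout.iff_span_pair_isPrincipal.mpr fun x y ↦ ?_
  rw [Ideal.span_insert]
  rcases hval (Ideal.span {x}) (Ideal.span {y}) with h | h
  · rw [sup_eq_right.mpr h]; exact ⟨⟨_, rfl⟩⟩
  · rw [sup_eq_left.mpr h]; exact ⟨⟨_, rfl⟩⟩

/-- For ideals `I` and `J`, membership in `I • J` as a submodule of the module `J` is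
membership in the product ideal. -/
theorem mem_smul_top_iff_coe_mem_mul {R : Type*} [CommRing R] (I J : Ideal R) (m : J) :
    m ∈ I • (⊤ : Submodule R J) ↔ (m : R) ∈ I * J := by
  rw [← SetLike.mem_coe, ← J.injective_subtype.mem_set_image, ← Submodule.map_coe, SetLike.mem_coe,
    Submodule.map_smul'', Submodule.map_top, Submodule.range_subtype, smul_eq_mul]
  rfl

/-- In a valuation ring `R` with maximal ideal `M`, `M` is flat iff
the annihilator `(0 : r)` is not finitely generated for every nonzero zero-divisor `r`. -/
theorem maximalIdeal_flat_iff_annihilator_not_fg (R : Type u) [CommRing R] [IsLocalRing R]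
    (hval : ∀ I J : Ideal R, I ≤ J ∨ J ≤ I) :
    Module.Flat R (IsLocalRing.maximalIdeal R) ↔
      ∀ r : R, r ≠ 0 → (∃ s : R, s ≠ 0 ∧ r * s = 0) → ¬ (Ideal.torsionOf R R r).FG := by
  have := isBezout_of_ideal_total hval
  simp only [flat_iff_mem_torsionOf_smul_top, mem_smul_top_iff_coe_mem_mul]
  constructor
  · rintro h r hr ⟨s, hs, hrs⟩ hfg
    refine hs ?_
    have hbot : Ideal.torsionOf R R r = ⊥ := by
      refine Submodule.eq_bot_of_le_smul_of_le_jacobson_bot (IsLocalRing.maximalIdeal R) _ hfg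
        (fun a ha ↦ ?_) (IsLocalRing.maximalIdeal_le_jacobson _)
      rw [Ideal.mem_torsionOf_iff, smul_eq_mul] at ha
      have haM : a ∈ IsLocalRing.maximalIdeal R := fun hu ↦ hr (hu.mul_right_eq_zero.mp ha)
      rw [smul_eq_mul, mul_comm]
      exact h r ⟨a, haM⟩ (Subtype.ext ((mul_comm r a).trans ha))
    rw [← Ideal.mem_bot, ← hbot, Ideal.mem_torsionOf_iff, smul_eq_mul, mul_comm, hrs]
  · rintro h r ⟨m, hm⟩ hrm
    replace hrm : r * m = 0 := congrArg Subtype.val hrm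
    have hmem : m ∈ Ideal.torsionOf R R r := by
      rwa [Ideal.mem_torsionOf_iff, smul_eq_mul, mul_comm]
    rcases eq_or_ne r 0 with rfl | hr
    · simpa using hm
    rcases eq_or_ne m 0 with rfl | hm0
    · exact zero_mem _
    have hlt : ¬ Ideal.torsionOf R R r ≤ Ideal.span {m} := fun hle ↦
      h r hr ⟨m, hm0, hrm⟩
        ⟨{m}, by simpa using (hle.antisymm ((Ideal.span_singleton_le_iff_mem _).mpr hmem)).symm⟩
    obtain ⟨b, hb, hbm⟩ := SetLike.not_le_iff_exists.mp hlt
    have hmb : Ideal.span {m} ≤ Ideal.span {b} := (hval _ _).resolve_right fun hle ↦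
      hbm (hle (Ideal.mem_span_singleton_self b))
    obtain ⟨c, rfl⟩ := Ideal.span_singleton_le_span_singleton.mp hmb
    refine Ideal.mul_mem_mul hb fun hc ↦ hbm ?_
    exact Ideal.mem_span_singleton.mpr (hc.mul_right_dvd.mpr dvd_rfl)
end

section
/- Let R be a valuation ring with maximal ideal M and set of zero-divisors Z. If Z ≠ 0 and Z ≠ M, then the λ-dimension of R equals 2. -/
open DirectSum

universe u

/-- If divisibility is total, every finite nonempty family has a member dividing all others. -/
theorem exists_dvd_forall_of_dvd_total {R ι : Type*} [CommRing R] [Finite ι] [Nonempty ι]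
    (hdvd : ∀ a b : R, a ∣ b ∨ b ∣ a) (x : ι → R) : ∃ i, ∀ j, x i ∣ x j := by
  have hdir : Directed (fun a b : R => b ∣ a) x := fun i j =>
    (hdvd (x i) (x j)).elim (fun h => ⟨i, dvd_rfl, h⟩) (fun h => ⟨j, h, dvd_rfl⟩)
  have : IsTrans R (fun a b : R => b ∣ a) := ⟨fun _ _ _ h₁ h₂ => h₂.trans h₁⟩
  exact hdir.finite_le id

/-- A finite module over a local ring has a finite generating family all of whose relations have
no unit coefficient. -/
theorem exists_surjective_forall_ker_not_isUnit (R N : Type*) [CommRing R] [AddCommGroup N]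
    [Module R N] [Module.Finite R N] :
    ∃ (n : ℕ) (p : (Fin n → R) →ₗ[R] N), Function.Surjective p ∧
      ∀ y, p y = 0 → ∀ i, ¬ IsUnit (y i) := by
  classical
  have hex : ∃ n : ℕ, ∃ v : Fin n → N, Submodule.span R (Set.range v) = ⊤ :=
    Module.Finite.exists_fin
  obtain ⟨v, hv⟩ := Nat.find_spec hex
  generalize hn : Nat.find hex = n at v
  refine ⟨n, Fintype.linearCombination R v, ?_, fun y hy i hi => ?_⟩
  · rw [← LinearMap.range_eq_top, Fintype.range_linearCombination, hv]
  · obtain _ | n := n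
    · exact i.elim0
    refine Nat.find_min hex (m := n) (by omega) ⟨v ∘ i.succAbove, ?_⟩
    rw [eq_top_iff, ← hv, Submodule.span_le]
    have hmem : ∀ j, v (i.succAbove j) ∈ Submodule.span R (Set.range (v ∘ i.succAbove)) :=
      fun j => Submodule.subset_span ⟨j, rfl⟩
    rintro _ ⟨j, rfl⟩
    obtain rfl | ⟨j, rfl⟩ := Fin.eq_self_or_eq_succAbove i j
    · rw [Fintype.linearCombination_apply, Fin.sum_univ_succAbove _ j] at hy
      refine (Submodule.smul_mem_iff_of_isUnit _ hi).1 ?_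
      rw [eq_neg_of_add_eq_zero_left hy]
      exact neg_mem (sum_mem fun l _ => Submodule.smul_mem _ _ (hmem l))
    · exact hmem j

/-- Over a local ring with total divisibility, a finitely presented module on which a nonunit `m`
acts injectively is free as soon as `m` divides all annihilators of its nonzero elements. -/
theorem Module.free_of_forall_smul_eq_zero_dvd {R N : Type*} [CommRing R] [IsLocalRing R]
    (hdvd : ∀ a b : R, a ∣ b ∨ b ∣ a) [AddCommGroup N] [Module R N]
    [Module.FinitePresentation R N] {m : R} (hm : m ∈ IsLocalRing.maximalIdeal R)
    (hreg : ∀ x : N, m • x = 0 → x = 0)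
    (htors : ∀ (c : R) (x : N), c • x = 0 → x ≠ 0 → m ∣ c) : Module.Free R N := by
  obtain ⟨n, p, hp, hker⟩ := exists_surjective_forall_ker_not_isUnit R N
  have hle : LinearMap.ker p ≤ Ideal.span {m} • LinearMap.ker p := by
    intro x hx
    rw [LinearMap.mem_ker] at hx
    rw [Submodule.ideal_span_singleton_smul]
    rcases isEmpty_or_nonempty (Fin n) with h | h
    · rw [Subsingleton.elim x 0]
      exact zero_mem _
    obtain ⟨i, hi⟩ := exists_dvd_forall_of_dvd_total hdvd x
    choose y hy using hi
    have hxy : x = x i • Function.update y i 1 := by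
      ext j
      by_cases hj : j = i
      · subst hj; simp
      · simpa [Function.update_of_ne hj] using hy j
    have hne : p (Function.update y i 1) ≠ 0 := fun h0 => hker _ h0 i (by simp)
    rw [hxy, map_smul] at hx
    obtain ⟨c, hc⟩ := htors _ _ hx hne
    have hcx : c • Function.update y i 1 ∈ LinearMap.ker p := by
      rw [LinearMap.mem_ker, map_smul]
      apply hreg
      rw [smul_smul, ← hc]
      exact hx
    rw [hxy, hc, mul_smul]
    exact Submodule.smul_mem_pointwise_smul _ _ _ hcx
  have hbot : LinearMap.ker p = ⊥ :=
    Submodule.eq_bot_of_le_smul_of_le_jacobson_bot (Ideal.span {m}) _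
      (Module.FinitePresentation.fg_ker p hp) hle
      (by rwa [IsLocalRing.jacobson_eq_maximalIdeal ⊥ bot_ne_top,
        Ideal.span_singleton_le_iff_mem])
  exact Module.Free.of_equiv (LinearEquiv.ofBijective p ⟨LinearMap.ker_eq_bot.1 hbot, hp⟩)

/-- The kernel of a surjection from a projective module onto `E` is projective if this holds for
one such surjection. -/
theorem Module.Projective.ker_of_projective_ker {R E P Q : Type*} [CommRing R] [AddCommGroup E]
    [Module R E] [AddCommGroup P] [Module R P] [AddCommGroup Q] [Module R Q]
    [Module.Projective R P] [Module.Projective R Q] (g : P →ₗ[R] E) (p : Q →ₗ[R] E)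
    (hg : Function.Surjective g) (hp : Function.Surjective p)
    [Module.Projective R (LinearMap.ker g)] : Module.Projective R (LinearMap.ker p) := by
  obtain ⟨h, hh⟩ := Module.projective_lifting_property g p hg
  obtain ⟨h', hh'⟩ := Module.projective_lifting_property p g hp
  have hh (t) : g (h t) = p t := LinearMap.congr_fun hh t
  have hh' (t) : p (h' t) = g t := LinearMap.congr_fun hh' t
  let i : LinearMap.ker p →ₗ[R] LinearMap.ker g × Q :=
    (h.restrict fun t ht => by simpa [hh] using ht).prod (LinearMap.ker p).subtype
  let s : LinearMap.ker g × Q →ₗ[R] LinearMap.ker p :=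
    LinearMap.codRestrict _
      ((h' ∘ₗ (LinearMap.ker g).subtype).coprod (LinearMap.id - h' ∘ₗ h))
      (fun z => by simp [hh, hh'])
  refine Module.Projective.of_split i s ?_
  refine LinearMap.ext fun t => Subtype.ext ?_
  change h' (h t) + (t - h' (h t)) = (t : Q)
  abel

/-- A module which is the cokernel of an injection between finite free modules has finite
`n`-presentations for all `n`. -/
theorem HasFiniteNPresentation.of_free_ker {R : Type u} [CommRing R] [Nontrivial R] {E : Type u}
    [AddCommGroup E] [Module R E] {k : ℕ} (g : (Fin k → R) →ₗ[R] E) (hg : Function.Surjective g)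
    [Module.Free R (LinearMap.ker g)] [Module.Finite R (LinearMap.ker g)] (n : ℕ) :
    HasFiniteNPresentation R E n := by
  let e := (Module.finBasis R (LinearMap.ker g)).equivFun.symm
  let d : ℕ → ℕ
    | 0 => k
    | 1 => Module.finrank R (LinearMap.ker g)
    | _ + 2 => 0
  let f : ∀ i : ℕ, ((Fin (d (i + 1)) → R) →ₗ[R] (Fin (d i) → R))
    | 0 => (LinearMap.ker g).subtype ∘ₗ e.toLinearMap
    | _ + 1 => 0
  refine ⟨d, f, g, hg, fun _ => ?_, fun i _ => ?_⟩
  · change LinearMap.range ((LinearMap.ker g).subtype ∘ₗ e.toLinearMap) = _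
    rw [LinearMap.range_comp_of_range_eq_top _ e.range, Submodule.range_subtype]
  · change LinearMap.range (0 : (Fin (d (i + 2)) → R) →ₗ[R] (Fin (d (i + 1)) → R)) = _
    rw [LinearMap.range_zero, eq_comm]
    obtain _ | i := i
    · change LinearMap.ker ((LinearMap.ker g).subtype ∘ₗ e.toLinearMap) = ⊥
      exact LinearMap.ker_eq_bot.2 (Subtype.val_injective.comp e.injective)
    · have : Subsingleton (Fin (d (i + 1 + 1)) → R) :=
        inferInstanceAs (Subsingleton (Fin 0 → R))
      exact Subsingleton.elim _ _

/-- A module with a finite `2`-presentation is the quotient of a finite free module by a finitely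
presented submodule. -/
theorem HasFiniteNPresentation.exists_finitePresentation_ker {R : Type u} [CommRing R] {E : Type u}
    [AddCommGroup E] [Module R E] (h : HasFiniteNPresentation R E 2) :
    ∃ (k : ℕ) (g : (Fin k → R) →ₗ[R] E), Function.Surjective g ∧
      Module.FinitePresentation R (LinearMap.ker g) := by
  obtain ⟨k, f, g, hg, h0, h1⟩ := h
  refine ⟨k 0, g, hg, ?_⟩
  rw [← h0 two_pos]
  refine Module.finitePresentation_of_surjective (f 0).rangeRestrict
    (f 0).surjective_rangeRestrict ?_
  rw [LinearMap.ker_rangeRestrict, ← h1 0 one_lt_two]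
  exact Submodule.FG.of_finite

/-- The quotient of a ring by a principal ideal has a finite `1`-presentation. -/
theorem hasFiniteNPresentation_one_quotient_span_singleton {R : Type u} [CommRing R] (a : R) :
    HasFiniteNPresentation R (R ⧸ Ideal.span {a}) 1 := by
  let e := LinearEquiv.funUnique (Fin 1) R R
  refine ⟨fun _ => 1, fun _ => a • LinearMap.id, (Ideal.span {a}).mkQ ∘ₗ e.toLinearMap,
    (Submodule.mkQ_surjective _).comp e.surjective, fun _ => ?_, fun i hi => by omega⟩
  ext x
  simp only [LinearMap.mem_range, LinearMap.mem_ker, LinearMap.smul_apply, LinearMap.id_apply,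
    LinearMap.comp_apply, LinearEquiv.coe_coe, Submodule.mkQ_apply, Submodule.Quotient.mk_eq_zero,
    Ideal.mem_span_singleton']
  constructor
  · rintro ⟨y, rfl⟩
    exact ⟨e y, by simp [e, mul_comm]⟩
  · rintro ⟨b, hb⟩
    refine ⟨e.symm b, e.injective ?_⟩
    rw [map_smul, e.apply_symm_apply, ← hb, smul_eq_mul, mul_comm]

/-- A projective principal ideal of a local ring is zero or generated by a regular element. -/
theorem eq_zero_or_eq_zero_of_projective_span_singleton {R : Type*} [CommRing R] [IsLocalRing R]
    {a s : R} [Module.Projective R (Ideal.span {a})] (h : a * s = 0) : a = 0 ∨ s = 0 := by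
  have : Module.Free R (Ideal.span {a}) := Module.free_of_flat_of_isLocalRing
  have key : ∀ x : Ideal.span {a}, s • x = 0 := by
    rintro ⟨x, hx⟩
    obtain ⟨y, rfl⟩ := Ideal.mem_span_singleton'.1 hx
    ext
    change s * (y * a) = 0
    linear_combination y * h
  let b := Module.Free.chooseBasis R (Ideal.span {a})
  rcases isEmpty_or_nonempty (Module.Free.ChooseBasisIndex R (Ideal.span {a})) with hι | ⟨⟨i⟩⟩
  · have := b.repr.toEquiv.subsingleton
    exact .inl (congrArg Subtype.val (Subsingleton.elim
      (⟨a, Ideal.mem_span_singleton_self a⟩ : Ideal.span {a}) 0))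
  · right
    simpa using congrArg (fun x => b.repr x i) (key (b i))

/-- A valuation ring whose set `Z` of zero-divisors satisfies
`Z ≠ 0` and `Z ≠ M` has `λ`-dimension exactly 2. -/
theorem lambdaDim_eq_two_of_valuationRing (R : Type u) [CommRing R] [IsLocalRing R]
    (hval : ∀ I J : Ideal R, I ≤ J ∨ J ≤ I)
    (hZ0 : ∃ r : R, r ≠ 0 ∧ ∃ s : R, s ≠ 0 ∧ r * s = 0)
    (hZM : {r : R | ∃ s : R, s ≠ 0 ∧ r * s = 0} ≠ (IsLocalRing.maximalIdeal R : Set R)) :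
    LambdaDimLE R 2 ∧ ¬ LambdaDimLE R 1 := by
  have hdvd (a b : R) : a ∣ b ∨ b ∣ a := by
    simpa only [Ideal.span_singleton_le_span_singleton] using
      (hval (Ideal.span {b}) (Ideal.span {a}))
  obtain ⟨m, hm, hreg⟩ : ∃ m ∈ IsLocalRing.maximalIdeal R, ∀ s : R, m * s = 0 → s = 0 := by
    by_contra! hcon
    refine hZM (Set.Subset.antisymm ?_ fun r hr => ?_)
    · rintro r ⟨s, hs, hrs⟩ hr
      exact hs ((IsUnit.mul_right_eq_zero hr).1 hrs)
    · obtain ⟨s, hrs, hs⟩ := hcon r hr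
      exact ⟨s, hs, hrs⟩
  have hm_dvd (c x : R) (hcx : c * x = 0) (hx : x ≠ 0) : m ∣ c := by
    refine (hdvd m c).resolve_right ?_
    rintro ⟨d, rfl⟩
    exact hx (hreg x (by linear_combination d * hcx))
  have hfree {k : ℕ} (N : Submodule R (Fin k → R)) [Module.FinitePresentation R N] :
      Module.Free R N := by
    refine Module.free_of_forall_smul_eq_zero_dvd hdvd hm (fun x hx => ?_) (fun c x hx hne => ?_)
    · ext j
      exact hreg _ (congrFun (congrArg Subtype.val hx) j)
    · obtain ⟨j, hj⟩ := Function.ne_iff.1 (Subtype.coe_ne_coe.2 hne)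
      exact hm_dvd c _ (congrFun (congrArg Subtype.val hx) j) hj
  constructor
  · intro E _ _ hE n
    obtain ⟨k, g, hg, hfp⟩ := hE.exists_finitePresentation_ker
    have := hfree (LinearMap.ker g)
    exact .of_free_ker g hg n
  · intro h
    obtain ⟨a, ha, s, hs, has⟩ := hZ0
    obtain ⟨k, g, hg, hfp⟩ := (h _ (hasFiniteNPresentation_one_quotient_span_singleton a)
      2).exists_finitePresentation_ker
    have := hfree (LinearMap.ker g)
    have hproj := Module.Projective.ker_of_projective_ker g (Ideal.span {a}).mkQ hg
      (Submodule.mkQ_surjective _)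
    rw [Submodule.ker_mkQ] at hproj
    exact (eq_zero_or_eq_zero_of_projective_span_singleton has).elim ha hs
end

section
/- Let R be a valuation ring with maximal ideal M. If R is a domain or R is not coherent, then M is a flat R-module and every R-module E with λ_R(E) = ∞ has flat dimension at most 1. -/
open DirectSum

universe u

namespace CategoryTheory.ShortComplex.ShortExact

open Limits ZeroObject

universe v v' w

variable {C : Type u} [Category.{v} C] [Abelian C] {S : ShortComplex C}

variable (S) in
/-- The terms of the complex `⋯ ⟶ 0 ⟶ S.X₁ ⟶ S.X₂` attached to a short complex `S`. -/
noncomputable def lengthOneX : ℕ → C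
  | 0 => S.X₂
  | 1 => S.X₁
  | _ + 2 => 0

variable (S) in
/-- The differentials of the complex `⋯ ⟶ 0 ⟶ S.X₁ ⟶ S.X₂`. -/
noncomputable def lengthOneD : ∀ n, lengthOneX S (n + 1) ⟶ lengthOneX S n
  | 0 => S.f
  | _ + 1 => 0

variable (S) in
/-- The chain complex `⋯ ⟶ 0 ⟶ S.X₁ ⟶ S.X₂` attached to a short complex `S`. -/
noncomputable def lengthOneComplex : ChainComplex C ℕ :=
  ChainComplex.of (lengthOneX S) (lengthOneD S) fun n => by
    cases n <;> exact zero_comp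

lemma lengthOneComplex_d_one_zero : (lengthOneComplex S).d 1 0 = S.f :=
  ChainComplex.of_d (lengthOneX S) (lengthOneD S) 0

lemma isZero_lengthOneComplex_X (n : ℕ) : IsZero ((lengthOneComplex S).X (n + 2)) :=
  isZero_zero C

lemma lengthOneComplex_exactAt_succ (hS : S.ShortExact) (n : ℕ) :
    (lengthOneComplex S).ExactAt (n + 1) := by
  have := hS.mono_f
  rw [HomologicalComplex.exactAt_iff' _ (n + 1 + 1) (n + 1) n (by simp) (by simp)]
  cases n with
  | zero =>
    rw [ShortComplex.exact_iff_mono _ ((isZero_lengthOneComplex_X (S := S) 0).eq_of_src _ _)]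
    change Mono ((lengthOneComplex S).d 1 0)
    rw [lengthOneComplex_d_one_zero]
    exact this
  | succ n => exact ShortComplex.exact_of_isZero_X₂ _ (isZero_lengthOneComplex_X (S := S) n)

/-- A short exact sequence whose first two terms are projective gives a projective resolution of
its third term. -/
noncomputable def projectiveResolution (hS : S.ShortExact) [Projective S.X₁] [Projective S.X₂] :
    ProjectiveResolution S.X₃ where
  complex := lengthOneComplex S
  projective n := by
    obtain _ | _ | n := n
    · exact inferInstanceAs (Projective S.X₂)
    · exact inferInstanceAs (Projective S.X₁)
    · exact inferInstanceAs (Projective (0 : C))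
  π := (ChainComplex.toSingle₀Equiv _ _).symm
    ⟨S.g, by rw [lengthOneComplex_d_one_zero]; exact S.zero⟩
  quasiIso := ⟨fun n => by
    have := hS.epi_g
    cases n
    · rw [ChainComplex.quasiIsoAt₀_iff, ShortComplex.quasiIso_iff_of_zeros']
      · refine (ShortComplex.exact_and_epi_g_iff_of_iso ?_).2 ⟨hS.exact, this⟩
        exact ShortComplex.isoMk (Iso.refl _) (Iso.refl _) (Iso.refl _)
          (by
            change 𝟙 _ ≫ S.f = (lengthOneComplex S).d 1 0 ≫ 𝟙 _
            rw [lengthOneComplex_d_one_zero]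
            exact (Category.id_comp _).trans (Category.comp_id _).symm)
          ((Category.id_comp _).trans ((Category.comp_id _).trans
            (ChainComplex.toSingle₀Equiv_symm_apply_f_zero
              (C := lengthOneComplex S) S.g _)).symm)
      all_goals rfl
    · rw [quasiIsoAt_iff_exactAt']
      · exact lengthOneComplex_exactAt_succ hS _
      · exact ChainComplex.exactAt_succ_single_obj ..⟩

/-- Left derived functors vanish from degree two on at an object with a projective resolution of
length one. -/
lemma isZero_leftDerived_obj_X₃ {D : Type w} [Category.{v'} D] [Abelian D]
    [HasProjectiveResolutions C] (hS : S.ShortExact)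
    [Projective S.X₁] [Projective S.X₂] (F : C ⥤ D) [F.Additive] (n : ℕ) :
    IsZero ((F.leftDerived (n + 2)).obj S.X₃) := by
  refine IsZero.of_iso ?_ (hS.projectiveResolution.isoLeftDerivedObj F (n + 2))
  exact ShortComplex.isZero_homology_of_isZero_X₂ _
    (F.map_isZero (isZero_lengthOneComplex_X n))

end CategoryTheory.ShortComplex.ShortExact

section DvdTotal

open IsLocalRing TensorProduct

variable {R : Type u} [CommRing R]

lemma dvd_total_of_ideal_le_total (hval : ∀ I J : Ideal R, I ≤ J ∨ J ≤ I) (a b : R) :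
    a ∣ b ∨ b ∣ a := by
  simpa only [Ideal.span_singleton_le_span_singleton, or_comm] using
    hval (Ideal.span {a}) (Ideal.span {b})

lemma Ideal.FG.exists_eq_span_singleton_of_dvd_total (hdvd : ∀ a b : R, a ∣ b ∨ b ∣ a)
    {I : Ideal R} (hI : I.FG) : ∃ a, I = Ideal.span {a} := by
  induction I, hI using Submodule.fg_induction with
  | singleton x => exact ⟨x, rfl⟩
  | sup I J _ _ hI hJ =>
    obtain ⟨a, rfl⟩ := hI
    obtain ⟨b, rfl⟩ := hJ
    rcases hdvd a b with h | h
    · exact ⟨a, sup_eq_left.2 (Ideal.span_singleton_le_span_singleton.2 h)⟩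
    · exact ⟨b, sup_eq_right.2 (Ideal.span_singleton_le_span_singleton.2 h)⟩

/-- If the annihilator of a single nonzero element is principal and nonzero, then all annihilators
are principal. -/
lemma exists_annihilator_generator_of_dvd_total (hdvd : ∀ a b : R, a ∣ b ∨ b ∣ a)
    {b c : R} (hb : b ≠ 0) (hc : c ≠ 0) (hann : ∀ y, b * y = 0 ↔ c ∣ y) (a : R) :
    ∃ e, ∀ y, a * y = 0 ↔ e ∣ y := by
  by_cases ha : a = 0
  · exact ⟨1, by simp [ha]⟩
  rcases hdvd a b with ⟨d, rfl⟩ | ⟨d, rfl⟩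
  · refine ⟨d * c, fun y => ⟨fun hy => ?_, ?_⟩⟩
    · rcases hdvd d y with ⟨z, rfl⟩ | ⟨z, rfl⟩
      · exact mul_dvd_mul_left d ((hann z).1 (by rw [mul_assoc, hy]))
      · exact absurd (by rw [← mul_assoc, hy, zero_mul]) hb
    · rintro ⟨z, rfl⟩
      linear_combination z * (hann c).2 dvd_rfl
  · obtain ⟨e, rfl⟩ : d ∣ c := by
      rcases hdvd d c with h | h
      · exact h
      · exact absurd ((hann d).2 h) ha
    refine ⟨e, fun y => ⟨fun hy => ?_, ?_⟩⟩
    · obtain ⟨r, hr⟩ := (hann (d * y)).1 (by rw [← mul_assoc, hy])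
      rcases hdvd e (y - e * r) with h | ⟨s, hs⟩
      · exact (dvd_sub_left (dvd_mul_right e r)).1 h
      · exact absurd (by rw [hs]; linear_combination s * hr) hc
    · rintro ⟨z, rfl⟩
      linear_combination z * (hann (d * e)).2 dvd_rfl

/-- If divisibility is total and all annihilators of elements are principal, then the ring is
coherent. -/
lemma isCoherentRing_of_annihilator_generator (hdvd : ∀ a b : R, a ∣ b ∨ b ∣ a)
    (h : ∀ a : R, ∃ e, ∀ y, a * y = 0 ↔ e ∣ y) : IsCoherentRing R := by
  intro I hI
  obtain ⟨a, rfl⟩ := hI.exists_eq_span_singleton_of_dvd_total hdvd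
  obtain ⟨e, he⟩ := h a
  refine Module.finitePresentation_of_free_of_surjective
    (LinearMap.toSpanSingleton R (Ideal.span {a})
      ⟨a, Ideal.mem_span_singleton_self a⟩) ?_ ⟨{e}, ?_⟩
  · rintro ⟨x, hx⟩
    obtain ⟨y, rfl⟩ := Ideal.mem_span_singleton'.1 hx
    exact ⟨y, rfl⟩
  · ext y
    rw [Finset.coe_singleton, LinearMap.mem_ker, LinearMap.toSpanSingleton_apply,
      Subtype.ext_iff]
    refine Ideal.mem_span_singleton.trans ((he y).symm.trans ?_)
    simp [mul_comm]

/-- In a valuation ring that is a domain or not coherent, no annihilator of a nonzero element is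
principal and nonzero. -/
lemma exists_annihilated_not_dvd (hdvd : ∀ a b : R, a ∣ b ∨ b ∣ a)
    (h : IsDomain R ∨ ¬ IsCoherentRing R) (b c : R) (hb : b ≠ 0) (hc : c ≠ 0)
    (hbc : b * c = 0) : ∃ y, b * y = 0 ∧ ¬ c ∣ y := by
  rcases h with _ | h
  · exact absurd hbc (mul_ne_zero hb hc)
  · by_contra! hdiv
    refine h (isCoherentRing_of_annihilator_generator hdvd
      (exists_annihilator_generator_of_dvd_total hdvd hb hc fun y => ⟨hdiv y, ?_⟩))
    rintro ⟨z, rfl⟩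
    rw [← mul_assoc, hbc, zero_mul]

variable [IsLocalRing R]

/-- If divisibility is total and no annihilator of a nonzero element is principal and nonzero, then
the maximal ideal is flat. -/
lemma flat_maximalIdeal_of_dvd_total (hdvd : ∀ a b : R, a ∣ b ∨ b ∣ a)
    (h : ∀ b c : R, b ≠ 0 → c ≠ 0 → b * c = 0 → ∃ y, b * y = 0 ∧ ¬ c ∣ y) :
    Module.Flat R (maximalIdeal R) := by
  rw [Module.Flat.iff_rTensor_injective]
  intro I hI
  obtain ⟨b, rfl⟩ := hI.exists_eq_span_singleton_of_dvd_total hdvd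
  set b' : Ideal.span {b} := ⟨b, Ideal.mem_span_singleton_self b⟩ with hb'
  have key (t : Ideal.span {b} ⊗[R] maximalIdeal R) : ∃ x, t = b' ⊗ₜ x := by
    induction t with
    | zero => exact ⟨0, by simp⟩
    | add s t hs ht =>
      obtain ⟨x, rfl⟩ := hs
      obtain ⟨y, rfl⟩ := ht
      exact ⟨x + y, by rw [tmul_add]⟩
    | tmul z x =>
      obtain ⟨z, hz⟩ := z
      obtain ⟨r, rfl⟩ := Ideal.mem_span_singleton'.1 hz
      exact ⟨r • x, by rw [← smul_tmul]; rfl⟩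
  rw [injective_iff_map_eq_zero]
  intro t ht
  obtain ⟨⟨x, hx⟩, rfl⟩ := key t
  have hbx : b * x = 0 := by
    simpa [hb'] using congrArg
      (fun u => ((TensorProduct.lid R (maximalIdeal R) u : maximalIdeal R) : R)) ht
  by_cases hb : b = 0
  · have : b' = 0 := Subtype.ext hb
    rw [this, zero_tmul]
  by_cases hx0 : x = 0
  · subst hx0
    exact tmul_zero _ _
  obtain ⟨y, hy, hxy⟩ := h b x hb hx0 hbx
  obtain ⟨m, rfl⟩ := (hdvd x y).resolve_left hxy
  have hm : m ∈ maximalIdeal R := fun hu => hxy (hu.mul_right_dvd.2 dvd_rfl)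
  have h1 : (⟨y * m, hx⟩ : maximalIdeal R) = y • ⟨m, hm⟩ := rfl
  have h2 : y • b' = 0 := Subtype.ext (by simpa [hb', mul_comm] using hy)
  rw [h1, ← smul_tmul, h2, zero_tmul]

/-- If the maximal ideal of a local ring is flat, then finitely presented submodules of flat modules
are free. -/
lemma Submodule.free_of_flat_maximalIdeal [Module.Flat R (maximalIdeal R)] {F : Type u}
    [AddCommGroup F] [Module R F] [Module.Flat R F] (K : Submodule R F)
    [Module.FinitePresentation R K] : Module.Free R K := by
  refine Module.free_of_maximalIdeal_rTensor_injective ?_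
  have h1 : Function.Injective (K.subtype.lTensor (maximalIdeal R)) :=
    Module.Flat.lTensor_preserves_injective_linearMap _ K.injective_subtype
  have h2 : Function.Injective ((maximalIdeal R).subtype.rTensor F) :=
    Module.Flat.rTensor_preserves_injective_linearMap _ (Submodule.injective_subtype _)
  have h3 := h2.comp h1
  rw [← LinearMap.coe_comp, LinearMap.rTensor_comp_lTensor,
    ← LinearMap.lTensor_comp_rTensor, LinearMap.coe_comp] at h3
  exact h3.of_comp

end DvdTotal

open CategoryTheory in
/-- A module has flat dimension at most one if it is a quotient of a free module by a free
submodule. -/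
lemma flatDimLE_one_of_free_ker {R : Type u} [CommRing R] {E F : Type u} [AddCommGroup E]
    [Module R E] [AddCommGroup F] [Module R F] [Module.Free R F] (g : F →ₗ[R] E)
    (hg : Function.Surjective g) [Module.Free R (LinearMap.ker g)] : FlatDimLE R E 1 := by
  refine ⟨1, le_rfl, fun N _ _ => ?_⟩
  let S : ShortComplex (ModuleCat.{u} R) :=
    ShortComplex.mk (ModuleCat.ofHom (LinearMap.ker g).subtype) (ModuleCat.ofHom g)
      (by ext x; exact x.2)
  have hS : S.ShortExact := ModuleCat.shortComplex_shortExact S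
    (LinearMap.exact_subtype_ker_map g) (Submodule.injective_subtype _) hg
  have : Projective S.X₁ := (IsProjective.iff_projective (LinearMap.ker g)).1 inferInstance
  have : Projective S.X₂ := (IsProjective.iff_projective F).1 inferInstance
  exact ModuleCat.subsingleton_of_isZero (hS.isZero_leftDerived_obj_X₃
    ((MonoidalCategory.tensoringLeft (ModuleCat.{u} R)).obj (ModuleCat.of R N)) 0)

/-- If a valuation ring `R` is a domain or is not coherent, then its
maximal ideal is flat and every module `E` with `λ_R(E) = ∞` has flat dimension at most 1. -/
theorem maximalIdeal_flat_and_flatDim_le_one (R : Type u) [CommRing R] [IsLocalRing R]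
    (hval : ∀ I J : Ideal R, I ≤ J ∨ J ≤ I)
    (h : IsDomain R ∨ ¬ IsCoherentRing R) :
    Module.Flat R (IsLocalRing.maximalIdeal R) ∧
    ∀ (E : Type u) [AddCommGroup E] [Module R E],
      (∀ n : ℕ, HasFiniteNPresentation R E n) → FlatDimLE R E 1 := by
  have hdvd := dvd_total_of_ideal_le_total hval
  have hflat := flat_maximalIdeal_of_dvd_total hdvd (exists_annihilated_not_dvd hdvd h)
  refine ⟨hflat, fun E _ _ hE => ?_⟩
  obtain ⟨k, f, g, hg, h0, h1⟩ := hE 2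
  have hK : LinearMap.range (f 0) = LinearMap.ker g := h0 two_pos
  have hker : (LinearMap.ker (f 0).rangeRestrict).FG := by
    rw [LinearMap.ker_rangeRestrict, ← h1 0 one_lt_two, LinearMap.range_eq_map]
    exact Module.Finite.fg_top.map _
  have : Module.FinitePresentation R (LinearMap.range (f 0)) :=
    Module.finitePresentation_of_free_of_surjective _ (f 0).surjective_rangeRestrict hker
  rw [hK] at this
  have := Submodule.free_of_flat_maximalIdeal (LinearMap.ker g)
  exact flatDimLE_one_of_free_ker g hg
end
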